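/- arXiv:2505.07097 — 2 statements merged into one kernel-verified Lean document; each statement's English description precedes it below -/
import Mathlib

section
/- Let λ ⊢ n, S a standard Young tableau of shape λ, T a bijective filling of λ by 1,…,n, and S^0 the standard Young tableau of shape λ whose entries 1,…,n fill the rows consecutively from top to bottom. Then the classical Specht polynomial F_T^{S^0} divides the higher Specht polynomial F_T^S in Q[x_1,…,x_n], and the quotient Q_T^S := F_T^S / F_T^{S^0} is a homogeneous polynomial with integer coefficients that is invariant under every element of the extended column group C̃(T). -/
open MvPolynomial

noncomputable section

namespace HigherSpecht

open scoped Classical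

/-- A tableau: a filling of the plane (row, column), `0`-indexed, with `0` outside the diagram. -/
abbrev Tab := ℕ × ℕ → ℕ

/-- A permutation of `ℕ` represents an element of `Sₙ` (acting on `{1, …, n}`)
when it fixes `0` and everything above `n`. -/
def SuppIn (n : ℕ) (w : Equiv.Perm ℕ) : Prop := ∀ i, i = 0 ∨ n < i → w i = i

/-- Descending locations of a permutation (one-line notation `w 1, …, w n`). -/
def DslSet (n : ℕ) (w : Equiv.Perm ℕ) : Finset ℕ :=
  (Finset.Ioo 0 n).filter fun i => w (i + 1) < w i

/-- Ascending locations of a permutation. -/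
def AslSet (n : ℕ) (w : Equiv.Perm ℕ) : Finset ℕ :=
  (Finset.Ioo 0 n).filter fun i => w i < w (i + 1)

/-- The row in which the entry `i` shows up in a tableau. -/
def rowIdx (T : Tab) (i : ℕ) : ℕ := sInf {r | ∃ c, T (r, c) = i}

/-- The column in which the entry `i` shows up in a tableau. -/
def colIdx (T : Tab) (i : ℕ) : ℕ := sInf {c | T (rowIdx T i, c) = i}

/-- The box containing the entry `i`. -/
def posOf (T : Tab) (i : ℕ) : ℕ × ℕ := (rowIdx T i, colIdx T i)

/-- Descending indices of a (standard) tableau: `i` with the row of `i+1` strictly below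
the row of `i`. -/
def DsiSet (n : ℕ) (T : Tab) : Finset ℕ :=
  (Finset.Ioo 0 n).filter fun i => rowIdx T i < rowIdx T (i + 1)

/-- `Dsi^c`, the complemented descent set `{n - i | i ∈ Dsi}`. -/
def Dsic (n : ℕ) (T : Tab) : Finset ℕ := (DsiSet n T).image fun i => n - i

/-- The entry of `ct_J(S)` at a box `c`: the number of elements of `J` smaller than the
entry of `S` at `c`. -/
def ctEntry (T : Tab) (J : Finset ℕ) (c : ℕ × ℕ) : ℕ := (J.filter fun j => j < T c).card

/-- The cocharge tableau `ct(S)` of a standard tableau. -/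
def ctTab (n : ℕ) (T : Tab) : Tab := fun c => ctEntry T (DsiSet n T) c

/-- The (total) cocharge `cc(S)`: the sum of the entries of `ct(S)`. -/
def ccStat (n : ℕ) (T : Tab) : ℕ :=
  ∑ i ∈ Finset.Icc 1 n, ctEntry T (DsiSet n T) (posOf T i)

/-- `T` is a bijective filling of the given set of cells by `1, …, n` (`n` the number of
cells), with `0` outside. -/
def IsFillingF (cells : Finset (ℕ × ℕ)) (T : Tab) : Prop :=
  (∀ c, c ∉ cells → T c = 0) ∧ Set.BijOn T ↑cells (Set.Icc 1 cells.card)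

/-- A bijective filling of a Young diagram. -/
def IsFilling (μ : YoungDiagram) (T : Tab) : Prop := IsFillingF μ.cells T

/-- A standard Young tableau of shape `μ`: entries strictly increase along rows and columns. -/
def IsStandard (μ : YoungDiagram) (T : Tab) : Prop :=
  IsFilling μ T ∧ ∀ c₁ ∈ μ.cells, ∀ c₂ ∈ μ.cells,
    c₁ ≠ c₂ → c₁.1 ≤ c₂.1 → c₁.2 ≤ c₂.2 → T c₁ < T c₂

/-! ### Robinson–Schensted -/

/-- Row insertion: insert `x` into a row, returning the new row and the bumped entry. -/
def rowInsert : ℕ → List ℕ → List ℕ × Option ℕ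
  | x, [] => ([x], none)
  | x, y :: ys =>
    if x < y then (x :: ys, some y)
    else
      let p := rowInsert x ys
      (y :: p.1, p.2)

/-- Insertion of an entry into a tableau, given as a list of rows. -/
def tabInsert : List (List ℕ) → ℕ → List (List ℕ)
  | [], x => [[x]]
  | r :: rs, x =>
    match rowInsert x r with
    | (r', none) => r' :: rs
    | (r', some y) => r' :: tabInsert rs y

/-- One-line notation of `w ∈ Sₙ`. -/
def oneLine (n : ℕ) (w : Equiv.Perm ℕ) : List ℕ := (List.range n).map fun i => w (i + 1)

/-- The insertion tableau of the first `m` letters of `w`, as a list of rows. -/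
def PtabListPart (n : ℕ) (w : Equiv.Perm ℕ) (m : ℕ) : List (List ℕ) :=
  ((oneLine n w).take m).foldl tabInsert []

/-- Entry of a list-of-rows tableau at a (0-indexed) cell. -/
def listEntry (t : List (List ℕ)) (c : ℕ × ℕ) : ℕ := (t.getD c.1 []).getD c.2 0

/-- The Robinson–Schensted insertion tableau `P(w)`. -/
def Ptab (n : ℕ) (w : Equiv.Perm ℕ) : Tab := fun c => listEntry (PtabListPart n w n) c

/-- The Robinson–Schensted recording tableau `Q(w)`: the entry of a cell is the step at
which the cell is added to the shape. -/
def Qtab (n : ℕ) (w : Equiv.Perm ℕ) : Tab := fun c =>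
  sInf {m | listEntry (PtabListPart n w m) c ≠ 0}

/-! ### Schützenberger evacuation -/

/-- One step of a jeu de taquin slide into the hole at `c`. -/
def slideOnce (T : Tab) (c : ℕ × ℕ) : Tab × (ℕ × ℕ) :=
  let rc : ℕ × ℕ := (c.1, c.2 + 1)
  let dc : ℕ × ℕ := (c.1 + 1, c.2)
  if T rc = 0 ∧ T dc = 0 then (T, c)
  else if T dc = 0 ∨ (T rc ≠ 0 ∧ T rc < T dc) then
    (Function.update (Function.update T c (T rc)) rc 0, rc)
  else
    (Function.update (Function.update T c (T dc)) dc 0, dc)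

/-- Jeu de taquin slide (with fuel). -/
def slide : ℕ → Tab → ℕ × ℕ → Tab × (ℕ × ℕ)
  | 0, T, c => (T, c)
  | k + 1, T, c =>
    let p := slideOnce T c
    if p.2 = c then (T, c) else slide k p.1 p.2

/-- The Schützenberger evacuation: repeatedly delete the minimal entry, slide into the hole,
decrement the remaining entries, and record the vacated cell. -/
def evacAux : ℕ → Tab → Tab
  | 0, _ => fun _ => 0
  | m + 1, T =>
    let c0 := posOf T 1
    let p := slide (m + 1) (Function.update T c0 0) c0
    Function.update (evacAux m fun c => p.1 c - 1) p.2 (m + 1)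

/-- The evacuation tableau `ev S` of a standard tableau with `n` boxes. -/
def evac (n : ℕ) (T : Tab) : Tab := evacAux n T

/-- `Q̃(w) := ev (Q w)`. -/
def Qt (n : ℕ) (w : Equiv.Perm ℕ) : Tab := evac n (Qtab n w)

/-! ### Row and column groups, higher Specht polynomials -/

/-- The identification of `Fin n` with `{1, …, n} ⊆ ℕ`. -/
def finShift (n : ℕ) : Fin n ≃ {i : ℕ // 1 ≤ i ∧ i ≤ n} where
  toFun j := ⟨(j : ℕ) + 1, by have := j.isLt; omega⟩
  invFun i := ⟨(i : ℕ) - 1, by have := i.2; omega⟩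
  left_inv j := by apply Fin.ext; simp
  right_inv i := by apply Subtype.ext; have := i.2; simp; omega

/-- Embedding of the permutations of `Fin n` into permutations of `ℕ` (acting on `{1, …, n}`). -/
def embedPerm (n : ℕ) (σ : Equiv.Perm (Fin n)) : Equiv.Perm ℕ :=
  σ.extendDomain (finShift n)

/-- The row group `R(T)` of a filling, as a finset of permutations of `Fin n`. -/
def rowFinset (n : ℕ) (T : Tab) : Finset (Equiv.Perm (Fin n)) :=
  Finset.univ.filter fun τ => ∀ i ∈ Finset.Icc 1 n, rowIdx T (embedPerm n τ i) = rowIdx T i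

/-- The column group `C(T)` of a filling, as a finset of permutations of `Fin n`. -/
def colFinset (n : ℕ) (T : Tab) : Finset (Equiv.Perm (Fin n)) :=
  Finset.univ.filter fun σ => ∀ i ∈ Finset.Icc 1 n, colIdx T (embedPerm n σ i) = colIdx T i

/-- The row group `R(T)` as a set of permutations of `ℕ`. -/
def rowGroupSet (n : ℕ) (T : Tab) : Set (Equiv.Perm ℕ) :=
  {w | SuppIn n w ∧ ∀ i ∈ Finset.Icc 1 n, rowIdx T (w i) = rowIdx T i}

/-- The column group `C(T)` as a set of permutations of `ℕ`. -/
def colGroupSet (n : ℕ) (T : Tab) : Set (Equiv.Perm ℕ) :=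
  {w | SuppIn n w ∧ ∀ i ∈ Finset.Icc 1 n, colIdx T (w i) = colIdx T i}

/-- The Young symmetrizer `ε_T = Σ_{σ ∈ C(T)} Σ_{τ ∈ R(T)} sgn(σ) σ τ` acting on polynomials
(permutations acting by permuting the variables). -/
def epsAct (n : ℕ) (T : Tab) (p : MvPolynomial ℕ ℚ) : MvPolynomial ℕ ℚ :=
  ∑ σ ∈ colFinset n T, ∑ τ ∈ rowFinset n T,
    (Equiv.Perm.sign σ : ℤ) • rename (⇑(embedPerm n σ * embedPerm n τ)) p

/-- The monomial `p_T^S = Π_i x_i^{h_i}`, where `h_i` is the entry of `ct S` in the box of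
`T` containing `i`. -/
def pTS (n : ℕ) (T S : Tab) : MvPolynomial ℕ ℚ :=
  ∏ i ∈ Finset.Icc 1 n, X i ^ ctEntry S (DsiSet n S) (posOf T i)

/-- `s_T^S`: the order of the stabilizer of `p_T^S` in `R(T)`. -/
def sTS (n : ℕ) (T S : Tab) : ℕ :=
  ((rowFinset n T).filter fun τ =>
    rename (⇑(embedPerm n τ)) (pTS n T S) = pTS n T S).card

/-- The higher Specht polynomial `F_T^S := ε_T p_T^S / s_T^S`. -/
def FTS (n : ℕ) (T S : Tab) : MvPolynomial ℕ ℚ :=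
  ((sTS n T S : ℚ)⁻¹) • epsAct n T (pTS n T S)

/-- The higher Specht polynomial `F_w := F_{P(w)}^{Q̃(w)}` of a permutation. -/
def Fw (n : ℕ) (w : Equiv.Perm ℕ) : MvPolynomial ℕ ℚ := FTS n (Ptab n w) (Qt n w)

/-- The elementary symmetric polynomial `e_r` in the variables `x_1, …, x_n`. -/
def esym (n r : ℕ) : MvPolynomial ℕ ℚ :=
  ∑ s ∈ (Finset.Icc 1 n).powersetCard r, ∏ i ∈ s, X i

/-- The representation `V^S`: the span of the higher Specht polynomials `F_T^S` over all
bijective fillings `T` of the given cells. -/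
def VS (n : ℕ) (cells : Finset (ℕ × ℕ)) (S : Tab) : Submodule ℚ (MvPolynomial ℕ ℚ) :=
  Submodule.span ℚ {p | ∃ T : Tab, IsFillingF cells T ∧ p = FTS n T S}

/-- Multiplication of a subspace of polynomials by a fixed polynomial. -/
def polyMul (q : MvPolynomial ℕ ℚ) (V : Submodule ℚ (MvPolynomial ℕ ℚ)) :
    Submodule ℚ (MvPolynomial ℕ ℚ) :=
  Submodule.map (LinearMap.mulLeft ℚ q) V

/-- The symmetric multiplier `Π_r e_r^{h_r}`. -/
def eProd (n : ℕ) (h : ℕ → ℕ) : MvPolynomial ℕ ℚ := ∏ r ∈ Finset.Icc 1 n, esym n r ^ h r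

/-- `V^S_h := (Π_r e_r^{h_r}) V^S`. -/
def VSh (n : ℕ) (cells : Finset (ℕ × ℕ)) (S : Tab) (h : ℕ → ℕ) :
    Submodule ℚ (MvPolynomial ℕ ℚ) :=
  polyMul (eProd n h) (VS n cells S)

/-! ### The representations `R_{n,I}` -/

/-- For `i ∈ I`, `r_i := #{j ∈ {1,…,n-1} \ I : j < i}`. -/
def rIdxI (n : ℕ) (I : Finset ℕ) (i : ℕ) : ℕ :=
  ((Finset.Ioo 0 n \ I).filter fun j => j < i).card

/-- The vector `h^S_I`, whose `r`-th entry (for `r ≥ 1`) is `#{i ∈ I \ Dsi^c(S) : r_i = r}`. -/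
def hSI (n : ℕ) (I : Finset ℕ) (S : Tab) : ℕ → ℕ := fun r =>
  if 1 ≤ r then ((I \ Dsic n S).filter fun i => rIdxI n I i = r).card else 0

/-- The indicator vector `h(I,S)` of the set `I \ Dsi^c(S)`. -/
def hInd (n : ℕ) (I : Finset ℕ) (S : Tab) : ℕ → ℕ := fun r =>
  if r ∈ I \ Dsic n S then 1 else 0

/-- `F_{w,I} := F_w · Π_{i ∈ I \ Dsl(w)} e_{r_i}`. -/
def FwI (n : ℕ) (I : Finset ℕ) (w : Equiv.Perm ℕ) : MvPolynomial ℕ ℚ :=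
  Fw n w * ∏ i ∈ I \ DslSet n w, esym n (rIdxI n I i)

/-- The homogeneous version `F^hom_{w,I} := F_w · Π_{i ∈ I \ Dsl(w)} e_i`. -/
def FwIhom (n : ℕ) (I : Finset ℕ) (w : Equiv.Perm ℕ) : MvPolynomial ℕ ℚ :=
  Fw n w * ∏ i ∈ I \ DslSet n w, esym n i

/-- The representation `R_{n,I}`: span of the `F_{w,I}` over `w` with `Dsl(w) ⊆ I`. -/
def RnI (n : ℕ) (I : Finset ℕ) : Submodule ℚ (MvPolynomial ℕ ℚ) :=
  Submodule.span ℚ {p | ∃ w : Equiv.Perm ℕ, SuppIn n w ∧ DslSet n w ⊆ I ∧ p = FwI n I w}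

/-- The homogeneous representation `R^hom_{n,I}`. -/
def RnIhom (n : ℕ) (I : Finset ℕ) : Submodule ℚ (MvPolynomial ℕ ℚ) :=
  Submodule.span ℚ {p | ∃ w : Equiv.Perm ℕ, SuppIn n w ∧ DslSet n w ⊆ I ∧ p = FwIhom n I w}

/-- The index type for the decomposition of `R_{n,I}`: pairs of a partition `λ ⊢ n` and a
standard Young tableau `S` of shape `λ` with `Dsi^c(S) ⊆ I`. -/
def SIdx (n : ℕ) (I : Finset ℕ) : Type :=
  {q : YoungDiagram × Tab // q.1.cells.card = n ∧ IsStandard q.1 q.2 ∧ Dsic n q.2 ⊆ I}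

/-! ### Ordered set partitions -/

/-- The cumulative values `j_h` attached to a subset `I ⊆ {1,…,n-1}` (`j_0 = 0`,
`j_h` the `h`-th smallest element, `j_{|I|+1} = n`). -/
def jval (n : ℕ) (I : Finset ℕ) (h : ℕ) : ℕ :=
  if h = 0 then 0 else if h ≤ I.card then (I.sort (· ≤ ·)).getD (h - 1) 0 else n

/-- The composition `comp_n I`, as a function of the index `0 ≤ h ≤ |I|`. -/
def compFun (n : ℕ) (I : Finset ℕ) (h : ℕ) : ℕ := jval n I (h + 1) - jval n I h

/-- The set `OP_{n,I}` of ordered set partitions of `{1,…,n}` into `|I| + 1` blocks whose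
sizes are given by `comp_n I` (blocks indexed by `ℕ`, empty from index `|I| + 1` on). -/
def OPset (n : ℕ) (I : Finset ℕ) : Set (ℕ → Finset ℕ) :=
  {B | (∀ h, I.card + 1 ≤ h → B h = ∅) ∧
       (∀ h₁ h₂, h₁ ≠ h₂ → Disjoint (B h₁) (B h₂)) ∧
       (∀ h ≤ I.card, (B h).card = compFun n I h) ∧
       Finset.Icc 1 n = (Finset.range (I.card + 1)).biUnion B}

/-- The natural action of a permutation on an ordered set partition. -/
def permOP (w : Equiv.Perm ℕ) (B : ℕ → Finset ℕ) : ℕ → Finset ℕ := fun h => (B h).image w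

/-! ### The quotient `R_{n,k}` -/

/-- Elementary symmetric polynomials in `Fin n` variables. -/
def esymFin (n r : ℕ) : MvPolynomial (Fin n) ℚ :=
  ∑ s ∈ (Finset.univ : Finset (Fin n)).powersetCard r, ∏ i ∈ s, X i

/-- The ideal defining `R_{n,k}`: generated by `x_i^k` and `e_r`, `n-k+1 ≤ r ≤ n`. -/
def Jnk (n k : ℕ) : Ideal (MvPolynomial (Fin n) ℚ) :=
  Ideal.span ((Set.range fun i : Fin n => (X i : MvPolynomial (Fin n) ℚ) ^ k) ∪
    {p | ∃ r, n - k + 1 ≤ r ∧ r ≤ n ∧ p = esymFin n r})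

/-- The map sending `x_i` (for `1 ≤ i ≤ n`) to the corresponding variable of
`ℚ[x_1, …, x_n]`, and all other variables to `0`. -/
def toFin (n : ℕ) : MvPolynomial ℕ ℚ →ₐ[ℚ] MvPolynomial (Fin n) ℚ :=
  aeval fun i => if h : 1 ≤ i ∧ i ≤ n then X (⟨i - 1, by omega⟩ : Fin n) else 0

/-- The quotient projection onto `R_{n,k}`. -/
def projNK (n k : ℕ) : MvPolynomial ℕ ℚ →ₐ[ℚ] (MvPolynomial (Fin n) ℚ ⧸ Jnk n k) :=
  (Ideal.Quotient.mkₐ ℚ (Jnk n k)).comp (toFin n)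

/-! ### Corners, insertions and the induction/extension operators -/

/-- `v` is an external corner of `μ`. -/
def IsCorner (μ : YoungDiagram) (v : ℕ × ℕ) : Prop :=
  v ∉ μ.cells ∧ ∃ ν : YoungDiagram, ν.cells = insert v μ.cells

/-- `S +̃ v := ev (ev S + v)`, where `+ v` places the entry `n + 1` in the box `v`. -/
def Sadd (n : ℕ) (S : Tab) (v : ℕ × ℕ) : Tab :=
  evac (n + 1) (Function.update (evac n S) v (n + 1))

/-- `δ^{S,v}`: `0` if `v` lies strictly below the row of `n` in `ev S`, and `1` otherwise. -/
def deltaSV (n : ℕ) (S : Tab) (v : ℕ × ℕ) : ℕ :=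
  if rowIdx (evac n S) n < v.1 then 0 else 1

/-- `h + δ·1_t`: add `δ` to the coordinate `t` of `h` when `t ≥ 1`; do nothing for `t = 0`. -/
def addAt (h : ℕ → ℕ) (t δ : ℕ) : ℕ → ℕ := fun r =>
  if r = t ∧ 1 ≤ t then h r + δ else h r

/-- The induction operator on a single summand:
`Ind_t V^S_h := ⊕_{v ∈ EC(λ)} V^{S +̃ v}_{h + δ^{S,v}·1_t}`. -/
def IndVSh (t n : ℕ) (μ : YoungDiagram) (S : Tab) (h : ℕ → ℕ) :
    Submodule ℚ (MvPolynomial ℕ ℚ) :=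
  ⨆ v : ℕ × ℕ, ⨆ _ : IsCorner μ v,
    VSh (n + 1) (insert v μ.cells) (Sadd n S v) (addAt h t (deltaSV n S v))

/-- The extension operator on a single summand:
`Ext V^S_h := ⊕_{v ∈ EC(λ), δ^{S,v} = 1} V^{S +̃ v}_h`. -/
def ExtVSh (n : ℕ) (μ : YoungDiagram) (S : Tab) (h : ℕ → ℕ) :
    Submodule ℚ (MvPolynomial ℕ ℚ) :=
  ⨆ v : ℕ × ℕ, ⨆ _ : IsCorner μ v ∧ deltaSV n S v = 1,
    VSh (n + 1) (insert v μ.cells) (Sadd n S v) h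

/-- `Ind_t R_{n,I}`, applied summand-by-summand to the decomposition of `R_{n,I}`. -/
def IndR (t n : ℕ) (I : Finset ℕ) : Submodule ℚ (MvPolynomial ℕ ℚ) :=
  ⨆ q : SIdx n I, IndVSh t n q.1.1 q.1.2 (hSI n I q.1.2)

/-- `Ext R_{n,I}`, applied summand-by-summand. -/
def ExtR (n : ℕ) (I : Finset ℕ) : Submodule ℚ (MvPolynomial ℕ ℚ) :=
  ⨆ q : SIdx n I, ExtVSh n q.1.1 q.1.2 (hSI n I q.1.2)

/-- `Ind_t R^hom_{n,I}`, applied summand-by-summand. -/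
def IndRhom (t n : ℕ) (I : Finset ℕ) : Submodule ℚ (MvPolynomial ℕ ℚ) :=
  ⨆ q : SIdx n I, IndVSh t n q.1.1 q.1.2 (hInd n I q.1.2)

/-- `Ext R^hom_{n,I}`, applied summand-by-summand. -/
def ExtRhom (n : ℕ) (I : Finset ℕ) : Submodule ℚ (MvPolynomial ℕ ℚ) :=
  ⨆ q : SIdx n I, ExtVSh n q.1.1 q.1.2 (hInd n I q.1.2)

/-- The lift `R̃_{n,k} = ⊕_{|I| = k-1} R_{n,I}` of the quotient `R_{n,k}`. -/
def Rtil (n k : ℕ) : Submodule ℚ (MvPolynomial ℕ ℚ) :=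
  ⨆ I : Finset ℕ, ⨆ _ : I ⊆ Finset.Ioo 0 n ∧ I.card + 1 = k, RnI n I

/-! ### The extended column group -/

/-- The length of column `c` of a tableau. -/
def colLenT (n : ℕ) (T : Tab) (c : ℕ) : ℕ :=
  ((Finset.range (n + 1)).filter fun r => T (r, c) ≠ 0).card

/-- `q_a`: the number of columns of length `> a` (columns of length `a` occupy the
`0`-indexed columns `q_a, …, q_a + t_a - 1`). -/
def qaT (n : ℕ) (T : Tab) (a : ℕ) : ℕ :=
  ((Finset.range (n + 1)).filter fun c => a < colLenT n T c).card

/-- `t_a`: the number of columns of length `a`. -/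
def taT (n : ℕ) (T : Tab) (a : ℕ) : ℕ :=
  ((Finset.range (n + 1)).filter fun c => colLenT n T c = a).card

/-- The function underlying the permutation `η_T`: the entry in row `j` of column `q_a + i`
is sent to the entry in row `j` of column `q_a + η(i)`; everything else is fixed. -/
def etaFun (n : ℕ) (T : Tab) (a : ℕ) (η : Equiv.Perm ℕ) : ℕ → ℕ := fun m =>
  let c := colIdx T m
  if 1 ≤ m ∧ m ≤ n ∧ qaT n T a ≤ c ∧ c < qaT n T a + taT n T a then
    T (rowIdx T m, qaT n T a + η (c - qaT n T a))
  else m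

/-- The set of the permutations `η_T` (over all `a ≥ 1` and all `η ∈ S_{t_a}`). -/
def etaSet (n : ℕ) (T : Tab) : Set (Equiv.Perm ℕ) :=
  {w | ∃ a, 1 ≤ a ∧ ∃ η : Equiv.Perm ℕ, (∀ i, taT n T a ≤ i → η i = i) ∧
    ⇑w = etaFun n T a η}

/-- The subgroup generated by the permutations `η_T` (a copy of `Π_a S_{t_a}`). -/
def etaSubgroup (n : ℕ) (T : Tab) : Subgroup (Equiv.Perm ℕ) :=
  Subgroup.closure (etaSet n T)

/-- The column group `C(T)` as a subgroup. -/
def colSubgroup (n : ℕ) (T : Tab) : Subgroup (Equiv.Perm ℕ) :=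
  Subgroup.closure (colGroupSet n T)

/-- The extended column group `C̃(T)`, generated by `C(T)` and the `η_T`. -/
def extColSubgroup (n : ℕ) (T : Tab) : Subgroup (Equiv.Perm ℕ) :=
  Subgroup.closure (colGroupSet n T ∪ etaSet n T)

/-- The sign of a permutation of `ℕ` supported on `{1, …, n}`. -/
def signOn (n : ℕ) (σ : Equiv.Perm ℕ) : ℤ :=
  if h : ∃ τ : Equiv.Perm (Fin n), embedPerm n τ = σ then
    (Equiv.Perm.sign h.choose : ℤ) else 0

/-! ### Semistandard tableaux, (generalized) cocharge tableaux -/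

/-- A semistandard filling of the given cells: rows weakly increase, columns strictly
increase (entries outside the cells are normalized to `0`). -/
def IsSSYTOn (cells : Finset (ℕ × ℕ)) (C : Tab) : Prop :=
  (∀ c ∉ cells, C c = 0) ∧
  (∀ c₁ ∈ cells, ∀ c₂ ∈ cells, c₁.1 = c₂.1 → c₁.2 ≤ c₂.2 → C c₁ ≤ C c₂) ∧
  (∀ c₁ ∈ cells, ∀ c₂ ∈ cells, c₁.2 = c₂.2 → c₁.1 < c₂.1 → C c₁ < C c₂)

/-- A generalized cocharge tableau with entries exactly `{0, …, k-1}`. -/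
def IsGCT (cells : Finset (ℕ × ℕ)) (C : Tab) (k : ℕ) : Prop :=
  IsSSYTOn cells C ∧ (∀ c ∈ cells, C c < k) ∧ ∀ h < k, ∃ c ∈ cells, C c = h

/-- The type of a generalized cocharge tableau: the set of cumulative multiplicities
`#{c : C c < h}` for `1 ≤ h ≤ k - 1`. -/
def gctType (cells : Finset (ℕ × ℕ)) (C : Tab) (k : ℕ) : Finset ℕ :=
  (Finset.Ico 1 k).image fun h => (cells.filter fun c => C c < h).card

/-- The standardization of a semistandard tableau: entries are replaced by `1, …, n`,
processing the values in increasing order and, for equal values, from left to right. -/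
def stdz (cells : Finset (ℕ × ℕ)) (C : Tab) : Tab := fun c =>
  if c ∈ cells then
    (cells.filter fun c' => C c' < C c ∨
      (C c' = C c ∧ (c'.2 < c.2 ∨ (c'.2 = c.2 ∧ c'.1 ≤ c.1)))).card
  else 0

/-- A cocharge tableau of shape `μ`: one of the form `ct S` for a standard `S`. -/
def IsCCT (μ : YoungDiagram) (C : Tab) : Prop :=
  ∃ S : Tab, IsStandard μ S ∧ ctTab μ.cells.card S = C

/-- `k` for a tableau: one more than the maximal entry. -/
def kOf (cells : Finset (ℕ × ℕ)) (C : Tab) : ℕ := cells.sup C + 1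

/-- `Dsp^c(C) := {n - i : i ∈ J}`, `J` the type of the cocharge tableau `C`. -/
def Dspc (n : ℕ) (cells : Finset (ℕ × ℕ)) (C : Tab) : Finset ℕ :=
  (gctType cells C (kOf cells C)).image fun i => n - i

/-- The entry sum `Σ(C)`. -/
def entrySum (cells : Finset (ℕ × ℕ)) (C : Tab) : ℕ := ∑ c ∈ cells, C c

/-- `C +̂ v := ct (ct⁻¹(C) +̃ v)`, where `ct⁻¹` is the standardization. -/
def Cadd (n : ℕ) (μ : YoungDiagram) (C : Tab) (v : ℕ × ℕ) : Tab :=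
  ctTab (n + 1) (Sadd n (stdz μ.cells C) v)

/-- The standard Young tableau `S⁰` of shape `μ` filling the rows consecutively. -/
def rowWordTab (μ : YoungDiagram) : Tab := fun c =>
  if c ∈ μ.cells then (∑ r ∈ Finset.range c.1, μ.rowLen r) + c.2 + 1 else 0

/-- The word of an ordered set partition: the blocks listed in order, each sorted
increasingly. -/
def opWord (k : ℕ) (B : ℕ → Finset ℕ) : List ℕ :=
  (List.range k).foldr (fun h acc => (B h).sort (· ≤ ·) ++ acc) []

/-- Renaming the variables of a power series along a permutation. -/
def permSeries (g : Equiv.Perm ℕ) (F : MvPowerSeries ℕ ℚ) : MvPowerSeries ℕ ℚ :=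
  fun m => F (Finsupp.mapDomain ⇑g⁻¹ m)



/-! ## General polynomial lemmas -/

lemma homog_quot {a b : ℕ} {F Q : MvPolynomial ℕ ℚ} (hF0 : F ≠ 0) (hF : F.IsHomogeneous a)
    (hFQ : (F * Q).IsHomogeneous b) : ∃ d, Q.IsHomogeneous d := by
  refine ⟨b - a, ?_⟩
  have key : ∀ j, a + j ≠ b → homogeneousComponent j Q = 0 := by
    intro j hj
    have h1 : homogeneousComponent (a + j) (F * Q) = 0 := by
      rw [homogeneousComponent_of_mem ((mem_homogeneousSubmodule _ _).2 hFQ), if_neg hj]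
    have h2 : homogeneousComponent (a + j) (F * Q) = F * homogeneousComponent j Q := by
      conv_lhs => rw [← sum_homogeneousComponent Q, Finset.mul_sum, map_sum]
      have : ∀ i, homogeneousComponent (a + j) (F * homogeneousComponent i Q)
          = if i = j then F * homogeneousComponent j Q else 0 := by
        intro i
        rw [homogeneousComponent_of_mem ((mem_homogeneousSubmodule _ _).2
          (hF.mul (homogeneousComponent_isHomogeneous i Q)))]
        by_cases h : i = j
        · subst h; simp
        · rw [if_neg (by omega), if_neg h]
      simp only [this]
      rw [Finset.sum_ite_eq']
      split_ifs with h
      · rfl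
      · rw [homogeneousComponent_eq_zero _ _ (by simpa using h), mul_zero]
    rw [h1] at h2
    exact (mul_eq_zero.1 h2.symm).resolve_left hF0
  intro d hd
  by_contra hne
  have h3 : coeff d (homogeneousComponent d.degree Q) = coeff d Q := by
    rw [coeff_homogeneousComponent, if_pos rfl]
  have h4 : a + d.degree = b := by
    by_contra h
    rw [key _ h] at h3
    exact hd (by simpa using h3.symm)
  apply hne
  have : Finsupp.weight 1 d = d.degree := by
    rw [Finsupp.degree_eq_weight_one]; rfl
  rw [this]; omega

/-- The substitution `x_j ↦ x_i`. -/
def collapse (i j : ℕ) : MvPolynomial ℕ ℤ →ₐ[ℤ] MvPolynomial ℕ ℤ :=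
  aeval fun k => if k = j then X i else X k

lemma dvd_of_collapse {i j : ℕ} {H : MvPolynomial ℕ ℤ} (h : collapse i j H = 0) :
    (X i - X j) ∣ H := by
  have h1 : ((Ideal.Quotient.mkₐ ℤ (Ideal.span {(X i - X j : MvPolynomial ℕ ℤ)})).comp
      (collapse i j)) = Ideal.Quotient.mkₐ ℤ (Ideal.span {(X i - X j : MvPolynomial ℕ ℤ)}) := by
    apply MvPolynomial.algHom_ext
    intro k
    simp only [collapse, AlgHom.comp_apply, aeval_X]
    split_ifs with hk
    · subst hk
      simp only [Ideal.Quotient.mkₐ_eq_mk]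
      rw [Ideal.Quotient.eq]
      exact Ideal.mem_span_singleton_self _
    · rfl
  have h2 := congrArg (fun f => f H) h1
  simp only [AlgHom.comp_apply, h, map_zero] at h2
  rw [← Ideal.mem_span_singleton, ← Ideal.Quotient.eq_zero_iff_mem]
  exact h2.symm

lemma collapse_anti {i j : ℕ} {H : MvPolynomial ℕ ℤ}
    (h : rename (Equiv.swap i j) H = -H) : collapse i j H = 0 := by
  have h1 : (collapse i j).comp (rename (Equiv.swap i j)) = collapse i j := by
    apply MvPolynomial.algHom_ext
    intro k
    simp only [collapse, AlgHom.comp_apply, aeval_X, rename_X]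
    rcases eq_or_ne k i with rfl | hki
    · simp
    · rcases eq_or_ne k j with rfl | hkj
      · simp
      · rw [Equiv.swap_apply_of_ne_of_ne hki hkj]
  have h2 := congrArg (fun f => f H) h1
  simp only [AlgHom.comp_apply, h, map_neg] at h2
  exact self_eq_neg.1 h2.symm

lemma collapse_ne {i j a b : ℕ} (hab : a ≠ b) (h1 : ¬ (a = i ∧ b = j)) (h2 : ¬ (a = j ∧ b = i)) :
    collapse i j (X a - X b) ≠ 0 := by
  simp only [collapse, map_sub, aeval_X]
  rw [sub_ne_zero]
  split_ifs with ha hb hb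
  · omega
  · intro h; have := X_injective h; omega
  · intro h; have := X_injective h; omega
  · intro h; have := X_injective h; omega

lemma vand_dvd (P : Finset (ℕ × ℕ)) (G : MvPolynomial ℕ ℤ)
    (hne : ∀ p ∈ P, p.1 ≠ p.2) (hasym : ∀ p ∈ P, (p.2, p.1) ∉ P)
    (hG : ∀ p ∈ P, rename (Equiv.swap p.1 p.2) G = -G) :
    (∏ p ∈ P, (X p.1 - X p.2)) ∣ G := by
  suffices h : ∀ P' ⊆ P, (∏ p ∈ P', (X p.1 - X p.2)) ∣ G from h P subset_rfl
  intro P'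
  induction P' using Finset.induction_on with
  | empty => intro _; simp
  | insert q s hq ih =>
    intro hs
    have hsP : s ⊆ P := fun x hx => hs (Finset.mem_insert_of_mem hx)
    have hqP : q ∈ P := hs (Finset.mem_insert_self _ _)
    obtain ⟨H, hH⟩ := ih hsP
    have h0 := collapse_anti (hG q hqP)
    rw [hH, map_mul, map_prod] at h0
    have h1 : collapse q.1 q.2 H = 0 := by
      refine (mul_eq_zero.1 h0).resolve_left ?_
      refine Finset.prod_ne_zero_iff.2 ?_
      intro p hp
      apply collapse_ne (hne p (hsP hp))
      · rintro ⟨e1, e2⟩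
        exact hq (by rwa [← Prod.ext (show p.1 = q.1 from e1) e2])
      · rintro ⟨e1, e2⟩
        apply hasym q hqP
        rw [← e1, ← e2]; exact hsP hp
    obtain ⟨K, hK⟩ := dvd_of_collapse h1
    rw [Finset.prod_insert hq, hH, hK]
    exact ⟨K, by ring⟩

/-! ## The symmetrizer -/

lemma emb_mul (n : ℕ) (σ τ : Equiv.Perm (Fin n)) :
    embedPerm n (σ * τ) = embedPerm n σ * embedPerm n τ :=
  (Equiv.Perm.extendDomain_mul _ _ _).symm

lemma emb_one (n : ℕ) : embedPerm n 1 = 1 := Equiv.Perm.extendDomain_one _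

lemma emb_inv (n : ℕ) (σ : Equiv.Perm (Fin n)) : embedPerm n σ⁻¹ = (embedPerm n σ)⁻¹ :=
  (Equiv.Perm.extendDomain_inv _ _).symm

lemma emb_fix (n : ℕ) (σ : Equiv.Perm (Fin n)) {i : ℕ} (h : ¬ (1 ≤ i ∧ i ≤ n)) :
    embedPerm n σ i = i :=
  Equiv.Perm.extendDomain_apply_not_subtype _ _ h

lemma emb_mem (n : ℕ) (σ : Equiv.Perm (Fin n)) {i : ℕ} (h : 1 ≤ i ∧ i ≤ n) :
    1 ≤ embedPerm n σ i ∧ embedPerm n σ i ≤ n := by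
  have := Equiv.Perm.extendDomain_apply_subtype σ (finShift n) h
  rw [embedPerm, this]
  exact (finShift n _).2

lemma exists_emb (n : ℕ) (w : Equiv.Perm ℕ) (hw : SuppIn n w) :
    ∃ π : Equiv.Perm (Fin n), embedPerm n π = w := by
  have h : ∀ i, (1 ≤ w i ∧ w i ≤ n) ↔ (1 ≤ i ∧ i ≤ n) := by
    intro i
    constructor
    · intro h
      by_contra hc
      rw [hw i (by omega)] at h
      exact hc h
    · intro h
      by_contra hc
      have := hw (w i) (by omega)
      have := w.injective this
      rw [this] at hc
      exact hc h
  refine ⟨(finShift n).symm.permCongr (w.subtypePerm h), ?_⟩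
  ext i
  by_cases hi : 1 ≤ i ∧ i ≤ n
  · rw [embedPerm, Equiv.Perm.extendDomain_apply_subtype _ (finShift n) hi]
    simp [Equiv.permCongr_apply]
  · rw [emb_fix n _ hi, hw i (by omega)]

lemma emb_swap (n : ℕ) {i j : ℕ} (hi : 1 ≤ i ∧ i ≤ n) (hj : 1 ≤ j ∧ j ≤ n) (hij : i ≠ j) :
    ∃ π : Equiv.Perm (Fin n), embedPerm n π = Equiv.swap i j ∧ Equiv.Perm.sign π = -1 := by
  refine ⟨Equiv.swap ((finShift n).symm ⟨i, hi⟩) ((finShift n).symm ⟨j, hj⟩), ?_, ?_⟩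
  · ext k
    by_cases hk : 1 ≤ k ∧ k ≤ n
    · rw [embedPerm, Equiv.Perm.extendDomain_apply_subtype _ (finShift n) hk]
      rw [Equiv.swap_apply_def, Equiv.swap_apply_def]
      simp only [EmbeddingLike.apply_eq_iff_eq, Subtype.mk.injEq]
      split_ifs <;> simp
    · rw [emb_fix n _ hk, Equiv.swap_apply_of_ne_of_ne] <;> rintro rfl <;> contradiction
  · apply Equiv.Perm.sign_swap
    simpa using hij

lemma mem_row (n : ℕ) (T : Tab) (τ : Equiv.Perm (Fin n)) :
    τ ∈ rowFinset n T ↔ ∀ i, rowIdx T (embedPerm n τ i) = rowIdx T i := by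
  simp only [rowFinset, Finset.mem_filter, Finset.mem_univ, true_and, Finset.mem_Icc]
  constructor
  · intro h i
    by_cases hi : 1 ≤ i ∧ i ≤ n
    · exact h i hi
    · rw [emb_fix n _ hi]
  · intro h i _
    exact h i

lemma mem_col (n : ℕ) (T : Tab) (τ : Equiv.Perm (Fin n)) :
    τ ∈ colFinset n T ↔ ∀ i, colIdx T (embedPerm n τ i) = colIdx T i := by
  simp only [colFinset, Finset.mem_filter, Finset.mem_univ, true_and, Finset.mem_Icc]
  constructor
  · intro h i
    by_cases hi : 1 ≤ i ∧ i ≤ n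
    · exact h i hi
    · rw [emb_fix n _ hi]
  · intro h i _
    exact h i

lemma mem_row' {n : ℕ} {T : Tab} {τ : Equiv.Perm (Fin n)}
    (h : ∀ i, 1 ≤ i ∧ i ≤ n → rowIdx T (embedPerm n τ i) = rowIdx T i) : τ ∈ rowFinset n T := by
  rw [mem_row]
  intro i
  by_cases hi : 1 ≤ i ∧ i ≤ n
  · exact h i hi
  · rw [emb_fix n _ hi]

lemma mem_col' {n : ℕ} {T : Tab} {τ : Equiv.Perm (Fin n)}
    (h : ∀ i, 1 ≤ i ∧ i ≤ n → colIdx T (embedPerm n τ i) = colIdx T i) : τ ∈ colFinset n T := by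
  rw [mem_col]
  intro i
  by_cases hi : 1 ≤ i ∧ i ≤ n
  · exact h i hi
  · rw [emb_fix n _ hi]

/-- The row group as a subgroup. -/
def rowSub (n : ℕ) (T : Tab) : Subgroup (Equiv.Perm (Fin n)) where
  carrier := {τ | τ ∈ rowFinset n T}
  one_mem' := by simp [mem_row, emb_one]
  mul_mem' := by
    intro a b ha hb
    simp only [Set.mem_ofPred_eq, mem_row, emb_mul, Equiv.Perm.mul_apply] at *
    intro i; rw [ha, hb]
  inv_mem' := by
    intro a ha
    simp only [Set.mem_ofPred_eq, mem_row, emb_inv] at *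
    intro i
    have h := ha ((embedPerm n a)⁻¹ i)
    simpa using h.symm

/-- The column group as a subgroup. -/
def colSub (n : ℕ) (T : Tab) : Subgroup (Equiv.Perm (Fin n)) where
  carrier := {τ | τ ∈ colFinset n T}
  one_mem' := by simp [mem_col, emb_one]
  mul_mem' := by
    intro a b ha hb
    simp only [Set.mem_ofPred_eq, mem_col, emb_mul, Equiv.Perm.mul_apply] at *
    intro i; rw [ha, hb]
  inv_mem' := by
    intro a ha
    simp only [Set.mem_ofPred_eq, mem_col, emb_inv] at *
    intro i
    have h := ha ((embedPerm n a)⁻¹ i)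
    simpa using h.symm

lemma mem_rowSub {n : ℕ} {T : Tab} {τ : Equiv.Perm (Fin n)} :
    τ ∈ rowSub n T ↔ τ ∈ rowFinset n T := Iff.rfl

lemma mem_colSub {n : ℕ} {T : Tab} {τ : Equiv.Perm (Fin n)} :
    τ ∈ colSub n T ↔ τ ∈ colFinset n T := Iff.rfl

lemma act_mul (n : ℕ) (σ τ : Equiv.Perm (Fin n)) (p : MvPolynomial ℕ ℚ) :
    rename (embedPerm n (σ * τ)) p = rename (embedPerm n σ) (rename (embedPerm n τ) p) := by
  rw [rename_rename, emb_mul]; rfl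

lemma act_inv_cancel (n : ℕ) (σ : Equiv.Perm (Fin n)) (p : MvPolynomial ℕ ℚ) :
    rename (embedPerm n σ⁻¹) (rename (embedPerm n σ) p) = p := by
  rw [← act_mul, inv_mul_cancel, emb_one]
  exact rename_id_apply p

/-- The row-orbit sum of `p_T^S`. -/
def gTS (n : ℕ) (T S : Tab) : MvPolynomial ℕ ℚ :=
  ∑ q ∈ (rowFinset n T).image (fun τ => rename (⇑(embedPerm n τ)) (pTS n T S)), q

lemma sTS_ne (n : ℕ) (T S : Tab) : sTS n T S ≠ 0 := by
  rw [sTS, Finset.card_ne_zero]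
  refine ⟨1, Finset.mem_filter.2 ⟨(rowSub n T).one_mem, ?_⟩⟩
  rw [emb_one]; exact rename_id_apply _

lemma row_sum (n : ℕ) (T S : Tab) :
    ∑ τ ∈ rowFinset n T, rename (⇑(embedPerm n τ)) (pTS n T S) = (sTS n T S) • gTS n T S := by
  rw [gTS, Finset.smul_sum]
  rw [Finset.sum_comp (fun q : MvPolynomial ℕ ℚ => q)
    (fun τ => rename (⇑(embedPerm n τ)) (pTS n T S))]
  apply Finset.sum_congr rfl
  intro q hq
  obtain ⟨τ₀, h0, rfl⟩ := Finset.mem_image.1 hq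
  congr 1
  rw [sTS]
  apply Finset.card_bij' (fun τ _ => τ₀⁻¹ * τ) (fun τ _ => τ₀ * τ)
  · intro τ hτ
    rw [Finset.mem_filter] at hτ ⊢
    refine ⟨(rowSub n T).mul_mem ((rowSub n T).inv_mem h0) hτ.1, ?_⟩
    rw [act_mul, hτ.2, act_inv_cancel]
  · intro τ hτ
    rw [Finset.mem_filter] at hτ ⊢
    refine ⟨(rowSub n T).mul_mem h0 hτ.1, ?_⟩
    rw [act_mul, hτ.2]
  · intro τ _; simp
  · intro τ _; simp

lemma FTS_eq (n : ℕ) (T S : Tab) :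
    FTS n T S = ∑ σ ∈ colFinset n T,
      (Equiv.Perm.sign σ : ℤ) • rename (⇑(embedPerm n σ)) (gTS n T S) := by
  have hs : (sTS n T S : ℚ) ≠ 0 := by exact_mod_cast sTS_ne n T S
  have h : epsAct n T (pTS n T S) = (sTS n T S : ℚ) • ∑ σ ∈ colFinset n T,
      (Equiv.Perm.sign σ : ℤ) • rename (⇑(embedPerm n σ)) (gTS n T S) := by
    rw [epsAct, Finset.smul_sum]
    apply Finset.sum_congr rfl
    intro σ _
    rw [← Finset.smul_sum, smul_comm]
    congr 1
    have : ∀ τ, rename (⇑(embedPerm n σ * embedPerm n τ)) (pTS n T S)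
        = rename (⇑(embedPerm n σ)) (rename (⇑(embedPerm n τ)) (pTS n T S)) := by
      intro τ; rw [← emb_mul, act_mul]
    simp only [this]
    rw [← map_sum, row_sum, map_nsmul, Nat.cast_smul_eq_nsmul]
  rw [FTS, h, smul_smul, inv_mul_cancel₀ hs, one_smul]

lemma gTS_row (n : ℕ) (T S : Tab) {ω : Equiv.Perm (Fin n)} (hω : ω ∈ rowFinset n T) :
    rename (⇑(embedPerm n ω)) (gTS n T S) = gTS n T S := by
  have h : (sTS n T S) • rename (⇑(embedPerm n ω)) (gTS n T S) = (sTS n T S) • gTS n T S := by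
    rw [← map_nsmul, ← row_sum, map_sum]
    apply Finset.sum_bij' (fun τ _ => ω * τ) (fun τ _ => ω⁻¹ * τ)
    · intro τ hτ; exact (rowSub n T).mul_mem hω hτ
    · intro τ hτ; exact (rowSub n T).mul_mem ((rowSub n T).inv_mem hω) hτ
    · intro τ _; simp
    · intro τ _; simp
    · intro τ _; rw [act_mul]
  exact smul_right_injective _ (sTS_ne n T S) h

lemma FTS_col (n : ℕ) (T S : Tab) {π : Equiv.Perm (Fin n)} (hπ : π ∈ colFinset n T) :
    rename (⇑(embedPerm n π)) (FTS n T S) = (Equiv.Perm.sign π : ℤ) • FTS n T S := by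
  rw [FTS_eq, map_sum, Finset.smul_sum]
  apply Finset.sum_bij' (fun τ _ => π * τ) (fun τ _ => π⁻¹ * τ)
  · intro τ hτ; exact (colSub n T).mul_mem hπ hτ
  · intro τ hτ; exact (colSub n T).mul_mem ((colSub n T).inv_mem hπ) hτ
  · intro τ _; simp
  · intro τ _; simp
  · intro τ _
    rw [map_zsmul, act_mul, smul_smul, Equiv.Perm.sign_mul]
    congr 1
    rcases Int.units_eq_one_or (Equiv.Perm.sign π) with h | h <;> simp [h]

lemma FTS_norm (n : ℕ) (T S : Tab) {ω : Equiv.Perm (Fin n)} (hω : ω ∈ rowFinset n T)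
    (h1 : ∀ σ ∈ colFinset n T, ω * σ * ω⁻¹ ∈ colFinset n T)
    (h2 : ∀ σ ∈ colFinset n T, ω⁻¹ * σ * ω ∈ colFinset n T) :
    rename (⇑(embedPerm n ω)) (FTS n T S) = FTS n T S := by
  rw [FTS_eq, map_sum]
  apply Finset.sum_bij' (fun σ _ => ω * σ * ω⁻¹) (fun σ _ => ω⁻¹ * σ * ω)
  · exact h1
  · exact h2
  · intro τ _; group
  · intro τ _; group
  · intro τ _
    rw [map_zsmul]
    congr 1
    · rcases Int.units_eq_one_or (Equiv.Perm.sign ω) with h | h <;> simp [h]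
    · conv_rhs => rw [← gTS_row n T S hω, ← act_mul]
      rw [← act_mul]
      congr 3
      group

lemma pTS_homog (n : ℕ) (T S : Tab) : (pTS n T S).IsHomogeneous
    (∑ i ∈ Finset.Icc 1 n, ctEntry S (DsiSet n S) (posOf T i)) := by
  apply IsHomogeneous.prod
  intro i _
  exact isHomogeneous_X_pow _ _

lemma FTS_homog (n : ℕ) (T S : Tab) : (FTS n T S).IsHomogeneous
    (∑ i ∈ Finset.Icc 1 n, ctEntry S (DsiSet n S) (posOf T i)) := by
  rw [FTS_eq]
  apply IsHomogeneous.sum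
  intro σ _
  rw [zsmul_eq_mul]
  have : (((Equiv.Perm.sign σ : ℤ)) : MvPolynomial ℕ ℚ) = C ((Equiv.Perm.sign σ : ℤ) : ℚ) := by
    simp
  rw [this]
  apply IsHomogeneous.C_mul
  apply IsHomogeneous.rename_isHomogeneous
  apply IsHomogeneous.sum
  intro q hq
  obtain ⟨τ₀, h0, rfl⟩ := Finset.mem_image.1 hq
  exact (pTS_homog n T S).rename_isHomogeneous

lemma FTS_int (n : ℕ) (T S : Tab) :
    ∃ G : MvPolynomial ℕ ℤ, map (Int.castRingHom ℚ) G = FTS n T S := by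
  suffices h : FTS n T S ∈ (map (σ := ℕ) (Int.castRingHom ℚ)).range from h
  rw [FTS_eq]
  apply Subring.sum_mem
  intro σ _
  apply Subring.zsmul_mem
  rw [gTS, map_sum]
  apply Subring.sum_mem
  intro q hq
  obtain ⟨τ₀, h0, rfl⟩ := Finset.mem_image.1 hq
  refine ⟨rename (⇑(embedPerm n σ)) (rename (⇑(embedPerm n τ₀))
    (∏ i ∈ Finset.Icc 1 n, X i ^ ctEntry S (DsiSet n S) (posOf T i))), ?_⟩
  rw [map_rename, map_rename, pTS, map_prod]
  simp

/-! ## Fillings -/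

lemma fill_ne {μ : YoungDiagram} {T : Tab} (hT : IsFilling μ T) {c : ℕ × ℕ} :
    T c ≠ 0 ↔ c ∈ μ.cells := by
  constructor
  · intro h
    by_contra hc
    exact h (hT.1 c hc)
  · intro h
    have := (hT.2.mapsTo h).1
    omega

lemma fill_pos {μ : YoungDiagram} {T : Tab} (hT : IsFilling μ T) {c : ℕ × ℕ} (hc : c ∈ μ.cells) :
    rowIdx T (T c) = c.1 ∧ colIdx T (T c) = c.2 := by
  have huniq : ∀ c', T c' = T c → c' = c := by
    intro c' h
    have h' : c' ∈ μ.cells := (fill_ne hT).1 (by rw [h]; exact (fill_ne hT).2 hc)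
    exact hT.2.injOn h' hc h
  have h1 : rowIdx T (T c) = c.1 := by
    have : {r | ∃ c', T (r, c') = T c} = {c.1} := by
      ext r
      constructor
      · rintro ⟨c', h⟩
        exact congrArg Prod.fst (huniq _ h)
      · rintro rfl
        exact ⟨c.2, rfl⟩
    rw [rowIdx, this, csInf_singleton]
  refine ⟨h1, ?_⟩
  have : {c' | T (c.1, c') = T c} = {c.2} := by
    ext r
    constructor
    · intro h
      exact congrArg Prod.snd (huniq _ h)
    · rintro rfl
      rfl
  rw [colIdx, h1, this, csInf_singleton]

lemma fill_inv {μ : YoungDiagram} {T : Tab} (hT : IsFilling μ T) {n : ℕ} (hμ : μ.cells.card = n)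
    {i : ℕ} (hi : 1 ≤ i ∧ i ≤ n) :
    (rowIdx T i, colIdx T i) ∈ μ.cells ∧ T (rowIdx T i, colIdx T i) = i := by
  obtain ⟨c, hc, rfl⟩ := hT.2.surjOn (show i ∈ Set.Icc 1 μ.cells.card from by
    rw [hμ]; exact hi)
  obtain ⟨h1, h2⟩ := fill_pos hT hc
  rw [h1, h2]
  exact ⟨hc, rfl⟩

/-! ## The row-reading tableau -/

lemma card_rows (μ : YoungDiagram) (k : ℕ) :
    (μ.cells.filter fun c => c.1 < k).card = ∑ r ∈ Finset.range k, μ.rowLen r := by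
  rw [Finset.card_eq_sum_card_fiberwise (f := Prod.fst) (t := Finset.range k)]
  · apply Finset.sum_congr rfl
    intro r hr
    rw [YoungDiagram.rowLen_eq_card]
    congr 1
    ext c
    simp only [Finset.mem_filter, YoungDiagram.mem_row_iff, YoungDiagram.mem_cells]
    have := Finset.mem_range.1 hr
    constructor
    · rintro ⟨⟨h1, h2⟩, h3⟩; exact ⟨h1, h3⟩
    · rintro ⟨h1, h3⟩; exact ⟨⟨h1, by omega⟩, h3⟩
  · intro c hc
    simpa using (Finset.mem_filter.1 hc).2

lemma sum_rows_le (μ : YoungDiagram) (k : ℕ) :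
    ∑ r ∈ Finset.range k, μ.rowLen r ≤ μ.cells.card := by
  rw [← card_rows]; exact Finset.card_filter_le _ _

lemma rowWord_apply {μ : YoungDiagram} {c : ℕ × ℕ} (hc : c ∈ μ.cells) :
    rowWordTab μ c = (∑ r ∈ Finset.range c.1, μ.rowLen r) + c.2 + 1 := by
  rw [rowWordTab, if_pos hc]

lemma rowWord_le {μ : YoungDiagram} {c : ℕ × ℕ} (hc : c ∈ μ.cells) {k : ℕ} (hk : c.1 < k) :
    rowWordTab μ c ≤ ∑ r ∈ Finset.range k, μ.rowLen r := by
  rw [rowWord_apply hc]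
  have h1 : c.2 < μ.rowLen c.1 := YoungDiagram.mem_iff_lt_rowLen.1 ((YoungDiagram.mem_cells _).1 hc)
  have h2 : ∑ r ∈ Finset.range (c.1 + 1), μ.rowLen r ≤ ∑ r ∈ Finset.range k, μ.rowLen r :=
    Finset.sum_le_sum_of_subset (Finset.range_mono hk)
  rw [Finset.sum_range_succ] at h2
  omega

lemma rowWord_filling (μ : YoungDiagram) : IsFilling μ (rowWordTab μ) := by
  have hmaps : ∀ c ∈ μ.cells, rowWordTab μ c ∈ Finset.Icc 1 μ.cells.card := by
    intro c hc
    rw [Finset.mem_Icc]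
    refine ⟨by rw [rowWord_apply hc]; omega, ?_⟩
    exact (rowWord_le hc (Nat.lt_succ_self _)).trans (sum_rows_le _ _)
  have hlt : ∀ c ∈ μ.cells, ∀ c' ∈ μ.cells, c.1 < c'.1 → rowWordTab μ c < rowWordTab μ c' := by
    intro c hc c' hc' h
    have := rowWord_le hc h
    rw [rowWord_apply hc']
    omega
  have hinj : Set.InjOn (rowWordTab μ) μ.cells := by
    intro c hc c' hc' h
    rcases lt_trichotomy c.1 c'.1 with h1 | h1 | h1
    · have := hlt c hc c' hc' h1; omega
    · rw [rowWord_apply hc, rowWord_apply hc', h1] at h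
      exact Prod.ext h1 (by omega)
    · have := hlt c' hc' c hc h1; omega
  refine ⟨fun c hc => by rw [rowWordTab, if_neg hc], ?_, hinj, ?_⟩
  · intro c hc
    have := hmaps c hc
    rwa [Finset.mem_Icc] at this
  · intro i hi
    have := Finset.surj_on_of_inj_on_of_card_le (s := μ.cells) (t := Finset.Icc 1 μ.cells.card)
      (fun c _ => rowWordTab μ c) hmaps (fun a b ha hb h => hinj ha hb h) (by simp) i
      (Finset.mem_Icc.2 hi)
    obtain ⟨c, hc, h⟩ := this
    exact ⟨c, hc, h.symm⟩

lemma rowWord_succ (μ : YoungDiagram) {m : ℕ} (h1 : 1 ≤ m) (h2 : m + 1 ≤ μ.cells.card) :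
    rowIdx (rowWordTab μ) (m + 1) = rowIdx (rowWordTab μ) m ∨
    rowIdx (rowWordTab μ) (m + 1) = rowIdx (rowWordTab μ) m + 1 := by
  have hF := rowWord_filling μ
  obtain ⟨c, hc, rfl⟩ := hF.2.surjOn (show m ∈ Set.Icc 1 μ.cells.card from ⟨h1, by omega⟩)
  have hr := (fill_pos hF hc).1
  by_cases hA : (c.1, c.2 + 1) ∈ μ.cells
  · left
    have e : rowWordTab μ c + 1 = rowWordTab μ (c.1, c.2 + 1) := by
      rw [rowWord_apply hc, rowWord_apply hA]; ring
    rw [e, (fill_pos hF hA).1, hr]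
  · have hlen : c.2 + 1 = μ.rowLen c.1 := by
      have a1 : c.2 < μ.rowLen c.1 := YoungDiagram.mem_iff_lt_rowLen.1 ((YoungDiagram.mem_cells _).1 hc)
      have a2 : ¬ c.2 + 1 < μ.rowLen c.1 := fun h =>
        hA ((YoungDiagram.mem_cells _).2 (YoungDiagram.mem_iff_lt_rowLen.2 h))
      omega
    have hval : rowWordTab μ c = ∑ r ∈ Finset.range (c.1 + 1), μ.rowLen r := by
      rw [rowWord_apply hc, Finset.sum_range_succ]; omega
    by_cases hB : (c.1 + 1, 0) ∈ μ.cells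
    · right
      have e : rowWordTab μ c + 1 = rowWordTab μ (c.1 + 1, 0) := by
        rw [hval, rowWord_apply hB]; rfl
      rw [e, (fill_pos hF hB).1, hr]
    · exfalso
      obtain ⟨c', hc', h'⟩ := hF.2.surjOn
        (show rowWordTab μ c + 1 ∈ Set.Icc 1 μ.cells.card from ⟨by omega, h2⟩)
      have : c'.1 < c.1 + 1 := by
        by_contra hlt
        apply hB
        rw [YoungDiagram.mem_cells]
        exact μ.up_left_mem (by omega) (Nat.zero_le c'.2) ((YoungDiagram.mem_cells _).1 hc')
      have := rowWord_le hc' this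
      omega

lemma ct_rowWord_aux (μ : YoungDiagram) (m : ℕ) (h1 : 1 ≤ m) (h2 : m ≤ μ.cells.card) :
    ((DsiSet μ.cells.card (rowWordTab μ)).filter fun j => j < m).card
      = rowIdx (rowWordTab μ) m := by
  have hF := rowWord_filling μ
  induction m, h1 using Nat.le_induction with
  | base =>
    have h0 : ((DsiSet μ.cells.card (rowWordTab μ)).filter fun j => j < 1) = ∅ := by
      ext j
      simp [DsiSet]
      omega
    rw [h0]
    have hc0 : ((0 : ℕ), (0 : ℕ)) ∈ μ.cells := by
      obtain ⟨c, hc⟩ := Finset.card_pos.1 (show 0 < μ.cells.card by omega)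
      rw [YoungDiagram.mem_cells] at hc ⊢
      exact μ.up_left_mem (Nat.zero_le c.1) (Nat.zero_le c.2) hc
    have e : rowWordTab μ (0, 0) = 1 := by rw [rowWord_apply hc0]; simp
    have := (fill_pos hF hc0).1
    rw [e] at this
    rw [this]; rfl
  | succ m hm ih =>
    have ih := ih (by omega)
    by_cases hd : rowIdx (rowWordTab μ) m < rowIdx (rowWordTab μ) (m + 1)
    · have : ((DsiSet μ.cells.card (rowWordTab μ)).filter fun j => j < m + 1)
          = insert m ((DsiSet μ.cells.card (rowWordTab μ)).filter fun j => j < m) := by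
        ext j
        simp only [Finset.mem_filter, Finset.mem_insert, DsiSet, Finset.mem_Ioo]
        constructor
        · rintro ⟨h, h'⟩
          by_cases e : j = m
          · exact Or.inl e
          · exact Or.inr ⟨h, by omega⟩
        · rintro (rfl | ⟨h, h'⟩)
          · exact ⟨⟨by omega, hd⟩, by omega⟩
          · exact ⟨h, by omega⟩
      rw [this, Finset.card_insert_of_notMem (by simp), ih]
      rcases rowWord_succ μ hm h2 with h | h <;> omega
    · have : ((DsiSet μ.cells.card (rowWordTab μ)).filter fun j => j < m + 1)
          = ((DsiSet μ.cells.card (rowWordTab μ)).filter fun j => j < m) := by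
        ext j
        simp only [Finset.mem_filter, DsiSet, Finset.mem_Ioo]
        constructor
        · rintro ⟨h, h'⟩
          refine ⟨h, ?_⟩
          by_contra hc
          have : j = m := by omega
          subst this
          exact hd h.2
        · rintro ⟨h, h'⟩
          exact ⟨h, by omega⟩
      rw [this, ih]
      rcases rowWord_succ μ hm h2 with h | h <;> omega

lemma ct_rowWord (μ : YoungDiagram) {c : ℕ × ℕ} (hc : c ∈ μ.cells) :
    ctEntry (rowWordTab μ) (DsiSet μ.cells.card (rowWordTab μ)) c = c.1 := by
  have hF := rowWord_filling μ
  have h := hF.2.mapsTo hc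
  rw [ctEntry, ct_rowWord_aux μ _ h.1 h.2, (fill_pos hF hc).1]

/-! ## The classical Specht polynomial -/

/-- The exponent vector `Σ row(i)·e_i`. -/
def rowExp (n : ℕ) (T : Tab) : ℕ →₀ ℕ := ∑ i ∈ Finset.Icc 1 n, Finsupp.single i (rowIdx T i)

lemma rowExp_apply (n : ℕ) (T : Tab) {i : ℕ} (hi : 1 ≤ i ∧ i ≤ n) :
    rowExp n T i = rowIdx T i := by
  rw [rowExp, Finsupp.finsetSum_apply]
  simp only [Finsupp.single_apply]
  rw [Finset.sum_ite_eq' ]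
  rw [if_pos (Finset.mem_Icc.2 hi)]

lemma rowExp_apply_out (n : ℕ) (T : Tab) {i : ℕ} (hi : ¬ (1 ≤ i ∧ i ≤ n)) :
    rowExp n T i = 0 := by
  rw [rowExp, Finsupp.finsetSum_apply]
  simp only [Finsupp.single_apply]
  rw [Finset.sum_ite_eq' ]
  rw [if_neg (by rwa [Finset.mem_Icc])]

lemma pTS_rowWord {n : ℕ} {μ : YoungDiagram} (hμ : μ.cells.card = n) {T : Tab}
    (hT : IsFilling μ T) : pTS n T (rowWordTab μ) = monomial (rowExp n T) 1 := by
  rw [pTS, rowExp, monomial_sum_one]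
  apply Finset.prod_congr rfl
  intro i hi
  have h := (fill_inv hT hμ (Finset.mem_Icc.1 hi)).1
  rw [X_pow_eq_monomial]
  subst hμ
  rw [posOf, ct_rowWord μ h]

lemma mapDomain_rowExp {n : ℕ} {T : Tab} {τ : Equiv.Perm (Fin n)} (hτ : τ ∈ rowFinset n T) :
    (rowExp n T).mapDomain (embedPerm n τ) = rowExp n T := by
  ext i
  obtain ⟨k, rfl⟩ := (embedPerm n τ).surjective i
  rw [Finsupp.mapDomain_apply (embedPerm n τ).injective]
  by_cases hk : 1 ≤ k ∧ k ≤ n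
  · rw [rowExp_apply n T hk, rowExp_apply n T (emb_mem n τ hk), (mem_row n T τ).1 hτ]
  · rw [emb_fix n τ hk]

lemma gTS_rowWord {n : ℕ} {μ : YoungDiagram} (hμ : μ.cells.card = n) {T : Tab}
    (hT : IsFilling μ T) : gTS n T (rowWordTab μ) = monomial (rowExp n T) 1 := by
  have : (rowFinset n T).image (fun τ => rename (⇑(embedPerm n τ)) (pTS n T (rowWordTab μ)))
      = {monomial (rowExp n T) 1} := by
    ext q
    rw [Finset.mem_image, Finset.mem_singleton, pTS_rowWord hμ hT]
    constructor
    · rintro ⟨τ, hτ, rfl⟩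
      rw [rename_monomial, mapDomain_rowExp hτ]
    · rintro rfl
      refine ⟨1, (rowSub n T).one_mem, ?_⟩
      rw [rename_monomial, mapDomain_rowExp (rowSub n T).one_mem]
  rw [gTS, this, Finset.sum_singleton]

lemma coeff_F0 {n : ℕ} {μ : YoungDiagram} (hμ : μ.cells.card = n) {T : Tab}
    (hT : IsFilling μ T) : coeff (rowExp n T) (FTS n T (rowWordTab μ)) = 1 := by
  rw [FTS_eq, coeff_sum, Finset.sum_eq_single 1]
  · rw [gTS_rowWord hμ hT, rename_monomial, mapDomain_rowExp (rowSub n T).one_mem]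
    simp
  · intro σ hσ hne
    rw [coeff_smul, gTS_rowWord hμ hT, rename_monomial, coeff_monomial, if_neg, smul_zero]
    intro h
    apply hne
    have hfix : embedPerm n σ = 1 := by
      ext i
      by_cases hi : 1 ≤ i ∧ i ≤ n
      · have hi' := emb_mem n σ hi
        have h1 := DFunLike.congr_fun h (embedPerm n σ i)
        rw [Finsupp.mapDomain_apply (embedPerm n σ).injective, rowExp_apply n T hi,
          rowExp_apply n T hi'] at h1
        have h2 := (mem_col n T σ).1 hσ i
        rw [← (fill_inv hT hμ hi').2, ← h1, h2, (fill_inv hT hμ hi).2]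
        rfl
      · rw [emb_fix n σ hi]; rfl
    exact Equiv.Perm.extendDomain_eq_one_iff.1 hfix
  · intro h
    exact absurd (colSub n T).one_mem h

/-- Pairs of entries in the same column, the first one above the second. -/
def colPairs (n : ℕ) (T : Tab) : Finset (ℕ × ℕ) :=
  (Finset.Icc 1 n ×ˢ Finset.Icc 1 n).filter fun p =>
    colIdx T p.1 = colIdx T p.2 ∧ rowIdx T p.1 < rowIdx T p.2

lemma mem_colPairs {n : ℕ} {T : Tab} {p : ℕ × ℕ} : p ∈ colPairs n T ↔
    ((1 ≤ p.1 ∧ p.1 ≤ n) ∧ (1 ≤ p.2 ∧ p.2 ≤ n)) ∧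
      colIdx T p.1 = colIdx T p.2 ∧ rowIdx T p.1 < rowIdx T p.2 := by
  simp [colPairs]

lemma card_colPairs {n : ℕ} {μ : YoungDiagram} (hμ : μ.cells.card = n) {T : Tab}
    (hT : IsFilling μ T) : ∑ i ∈ Finset.Icc 1 n, rowIdx T i ≤ (colPairs n T).card := by
  rw [Finset.card_eq_sum_card_fiberwise (f := Prod.snd) (t := Finset.Icc 1 n)
    (fun p hp => by simpa using (mem_colPairs.1 hp).1.2)]
  apply Finset.sum_le_sum
  intro j hj
  obtain ⟨hc, hTj⟩ := fill_inv hT hμ (Finset.mem_Icc.1 hj)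
  have hmem : ∀ r < rowIdx T j, (r, colIdx T j) ∈ μ.cells := by
    intro r hr
    rw [YoungDiagram.mem_cells] at hc ⊢
    exact μ.up_left_mem hr.le le_rfl hc
  conv_lhs => rw [← Finset.card_range (rowIdx T j)]
  apply Finset.card_le_card_of_injOn (fun r => (T (r, colIdx T j), j))
  · intro r hr
    have hr := Finset.mem_range.1 hr
    have hm := hmem r hr
    obtain ⟨h1, h2⟩ := fill_pos hT hm
    have h3 := hT.2.mapsTo hm
    rw [hμ] at h3
    refine Finset.mem_coe.2 (Finset.mem_filter.2 ⟨mem_colPairs.2 ?_, rfl⟩)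
    simp only [h1, h2]
    exact ⟨⟨h3, Finset.mem_Icc.1 hj⟩, trivial, hr⟩
  · intro r hr r' hr' h
    have h := congrArg Prod.fst h
    have := hT.2.injOn (hmem r (Finset.mem_range.1 hr)) (hmem r' (Finset.mem_range.1 hr')) h
    exact congrArg Prod.fst this

lemma FTS_swap {n : ℕ} {T S : Tab} {p : ℕ × ℕ} (hp : p ∈ colPairs n T) :
    rename (Equiv.swap p.1 p.2) (FTS n T S) = - FTS n T S := by
  obtain ⟨⟨h1, h2⟩, h3, h4⟩ := mem_colPairs.1 hp
  obtain ⟨π, hπ, hs⟩ := emb_swap n h1 h2 (by rintro h; rw [h] at h4; omega)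
  have hC : π ∈ colFinset n T := by
    rw [mem_col]
    intro i
    rw [hπ, Equiv.swap_apply_def]
    split_ifs with ha hb
    · rw [ha, h3]
    · rw [hb, h3]
    · rfl
  rw [← hπ, FTS_col n T S hC, hs]
  simp

lemma vand_dvd_G {n : ℕ} {T S : Tab} {G : MvPolynomial ℕ ℤ}
    (hG : map (Int.castRingHom ℚ) G = FTS n T S) :
    (∏ p ∈ colPairs n T, (X p.1 - X p.2)) ∣ G := by
  apply vand_dvd
  · intro p hp h
    have := (mem_colPairs.1 hp).2.2
    rw [h] at this; omega
  · intro p hp hp'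
    have h1 := (mem_colPairs.1 hp).2.2
    have h2 := (mem_colPairs.1 hp').2.2
    simp only at h2
    omega
  · intro p hp
    apply map_injective _ (RingHom.injective_int (Int.castRingHom ℚ))
    rw [map_rename, hG, FTS_swap hp, map_neg, hG]

lemma int_dvd {n : ℕ} {μ : YoungDiagram} (hμ : μ.cells.card = n) {S T : Tab}
    (hT : IsFilling μ T) : ∃ q : MvPolynomial ℕ ℤ,
      FTS n T S = FTS n T (rowWordTab μ) * map (Int.castRingHom ℚ) q := by
  obtain ⟨G, hG⟩ := FTS_int n T S
  obtain ⟨G0, hG0⟩ := FTS_int n T (rowWordTab μ)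
  obtain ⟨k, hk⟩ := vand_dvd_G hG
  obtain ⟨c, hc⟩ := vand_dvd_G hG0
  have hcoef : coeff (rowExp n T) G0 = 1 := by
    have h := coeff_F0 hμ hT
    rw [← hG0, coeff_map, eq_intCast] at h
    exact_mod_cast h
  have hG0ne : G0 ≠ 0 := by
    rintro rfl
    simp at hcoef
  set V : MvPolynomial ℕ ℤ := ∏ p ∈ colPairs n T, (X p.1 - X p.2) with hV
  have hVne : V ≠ 0 := by rintro h; rw [h, zero_mul] at hc; exact hG0ne hc
  have hcne : c ≠ 0 := by rintro h; rw [h, mul_zero] at hc; exact hG0ne hc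
  have hVhom : V.IsHomogeneous (colPairs n T).card := by
    have := IsHomogeneous.prod (colPairs n T)
      (fun p => (X p.1 - X p.2 : MvPolynomial ℕ ℤ)) (fun _ => 1)
      (fun p _ => (isHomogeneous_X _ _).sub (isHomogeneous_X _ _))
    simpa using this
  have hG0hom := FTS_homog n T (rowWordTab μ)
  rw [← hG0] at hG0hom
  have hG0hom := IsHomogeneous.of_map (RingHom.injective_int (Int.castRingHom ℚ)) hG0hom
  have hdeg : ∑ i ∈ Finset.Icc 1 n,
      ctEntry (rowWordTab μ) (DsiSet n (rowWordTab μ)) (posOf T i)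
      = ∑ i ∈ Finset.Icc 1 n, rowIdx T i := by
    apply Finset.sum_congr rfl
    intro i hi
    have h := (fill_inv hT hμ (Finset.mem_Icc.1 hi)).1
    have h' := ct_rowWord μ h
    rw [hμ] at h'
    exact h'
  have htd : c.totalDegree = 0 := by
    have h1 := totalDegree_mul_of_isDomain hVne hcne
    rw [← hc, hVhom.totalDegree hVne, hG0hom.totalDegree hG0ne, hdeg] at h1
    have := card_colPairs hμ hT
    omega
  rw [totalDegree_eq_zero_iff_eq_C] at htd
  set z := coeff 0 c
  have hz : coeff (rowExp n T) V * z = 1 := by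
    rw [← hcoef, hc, htd, mul_comm V, coeff_C_mul, mul_comm]
  set u := coeff (rowExp n T) V
  refine ⟨C u * k, ?_⟩
  rw [← hG, ← hG0, ← map_mul, hk, hc, htd]
  congr 1
  have : (C u * C z : MvPolynomial ℕ ℤ) = 1 := by rw [← C_mul, hz, C_1]
  linear_combination (- V * k) * this

/-! ## The column permutations -/

lemma card_le_of_mem {μ : YoungDiagram} {r c : ℕ} (h : (r, c) ∈ μ) :
    r < μ.cells.card ∧ c < μ.cells.card := by
  constructor
  · have : (Finset.range (r + 1)).card ≤ μ.cells.card := by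
      apply Finset.card_le_card_of_injOn (fun k => (k, c))
      · intro k hk
        have := Finset.mem_range.1 hk
        exact (YoungDiagram.mem_cells _).2 (μ.up_left_mem (by omega) le_rfl h)
      · intro a _ b _ hab; exact congrArg Prod.fst hab
    rw [Finset.card_range] at this; omega
  · have : (Finset.range (c + 1)).card ≤ μ.cells.card := by
      apply Finset.card_le_card_of_injOn (fun k => (r, k))
      · intro k hk
        have := Finset.mem_range.1 hk
        exact (YoungDiagram.mem_cells _).2 (μ.up_left_mem le_rfl (by omega) h)
      · intro a _ b _ hab; exact congrArg Prod.snd hab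
    rw [Finset.card_range] at this; omega

lemma rowLen_le_card (μ : YoungDiagram) (r : ℕ) : μ.rowLen r ≤ μ.cells.card := by
  by_contra h
  have := card_le_of_mem (YoungDiagram.mem_iff_lt_rowLen.2 (not_le.1 h))
  omega

lemma colLen_le_card (μ : YoungDiagram) (c : ℕ) : μ.colLen c ≤ μ.cells.card := by
  by_contra h
  have := card_le_of_mem (YoungDiagram.mem_iff_lt_colLen.2 (not_le.1 h))
  omega

lemma colLenT_eq {n : ℕ} {μ : YoungDiagram} (hμ : μ.cells.card = n) {T : Tab}
    (hT : IsFilling μ T) (c : ℕ) : colLenT n T c = μ.colLen c := by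
  have : (Finset.range (n + 1)).filter (fun r => T (r, c) ≠ 0) = Finset.range (μ.colLen c) := by
    ext r
    rw [Finset.mem_filter, fill_ne hT, YoungDiagram.mem_cells, YoungDiagram.mem_iff_lt_colLen,
      Finset.mem_range, Finset.mem_range]
    have := colLen_le_card μ c
    omega
  rw [colLenT, this, Finset.card_range]

lemma lt_colLen_iff (μ : YoungDiagram) (a c : ℕ) : a < μ.colLen c ↔ c < μ.rowLen a := by
  rw [← YoungDiagram.mem_iff_lt_colLen, YoungDiagram.mem_iff_lt_rowLen]

lemma qaT_eq {n : ℕ} {μ : YoungDiagram} (hμ : μ.cells.card = n) {T : Tab}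
    (hT : IsFilling μ T) (a : ℕ) : qaT n T a = μ.rowLen a := by
  have : (Finset.range (n + 1)).filter (fun c => a < colLenT n T c)
      = Finset.range (μ.rowLen a) := by
    ext c
    rw [Finset.mem_filter, colLenT_eq hμ hT, lt_colLen_iff, Finset.mem_range, Finset.mem_range]
    have := rowLen_le_card μ a
    omega
  rw [qaT, this, Finset.card_range]

lemma taT_eq {n : ℕ} {μ : YoungDiagram} (hμ : μ.cells.card = n) {T : Tab}
    (hT : IsFilling μ T) {a : ℕ} (ha : 1 ≤ a) : taT n T a = μ.rowLen (a - 1) - μ.rowLen a := by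
  have : (Finset.range (n + 1)).filter (fun c => colLenT n T c = a)
      = Finset.Ico (μ.rowLen a) (μ.rowLen (a - 1)) := by
    ext c
    rw [Finset.mem_filter, colLenT_eq hμ hT, Finset.mem_range, Finset.mem_Ico]
    have h1 := lt_colLen_iff μ a c
    have h2 := lt_colLen_iff μ (a - 1) c
    have := rowLen_le_card μ (a - 1)
    omega
  rw [taT, this, Nat.card_Ico]

/-- The permutation of column indices underlying `η_T`. -/
def thetaFun (q t : ℕ) (η : Equiv.Perm ℕ) (c : ℕ) : ℕ :=
  if q ≤ c ∧ c < q + t then q + η (c - q) else c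

lemma eta_lt {t : ℕ} {η : Equiv.Perm ℕ} (hη : ∀ i, t ≤ i → η i = i) {i : ℕ} (hi : i < t) :
    η i < t := by
  by_contra h
  have := η.injective (hη (η i) (not_lt.1 h))
  omega

lemma theta_inj {q t : ℕ} {η : Equiv.Perm ℕ} (hη : ∀ i, t ≤ i → η i = i) :
    Function.Injective (thetaFun q t η) := by
  intro a b h
  unfold thetaFun at h
  split_ifs at h with h1 h2 h2
  · have := η.injective (Nat.add_left_cancel h)
    omega
  · have := eta_lt hη (show a - q < t by omega)
    omega
  · have := eta_lt hη (show b - q < t by omega)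
    omega
  · exact h

lemma etaFun_spec {n : ℕ} {μ : YoungDiagram} (hμ : μ.cells.card = n) {T : Tab}
    (hT : IsFilling μ T) {a : ℕ} (ha : 1 ≤ a) {η : Equiv.Perm ℕ}
    (hη : ∀ i, taT n T a ≤ i → η i = i) {m : ℕ} (hm : 1 ≤ m ∧ m ≤ n) :
    rowIdx T (etaFun n T a η m) = rowIdx T m ∧
    colIdx T (etaFun n T a η m) = thetaFun (qaT n T a) (taT n T a) η (colIdx T m) := by
  obtain ⟨hc, hTm⟩ := fill_inv hT hμ hm
  by_cases h : qaT n T a ≤ colIdx T m ∧ colIdx T m < qaT n T a + taT n T a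
  · have e1 : etaFun n T a η m
        = T (rowIdx T m, qaT n T a + η (colIdx T m - qaT n T a)) := by
      rw [etaFun]; exact if_pos ⟨hm.1, hm.2, h⟩
    have e2 : thetaFun (qaT n T a) (taT n T a) η (colIdx T m)
        = qaT n T a + η (colIdx T m - qaT n T a) := if_pos h
    have hlt := eta_lt hη (show colIdx T m - qaT n T a < taT n T a by omega)
    have hmem : (rowIdx T m, qaT n T a + η (colIdx T m - qaT n T a)) ∈ μ.cells := by
      rw [YoungDiagram.mem_cells] at hc ⊢
      rw [qaT_eq hμ hT, taT_eq hμ hT ha] at *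
      have hr : rowIdx T m < a := by
        by_contra hr
        have := YoungDiagram.mem_iff_lt_rowLen.1 (μ.up_left_mem (not_lt.1 hr) le_rfl hc)
        omega
      have h2 : (a - 1, μ.rowLen a + η (colIdx T m - μ.rowLen a)) ∈ μ := by
        rw [YoungDiagram.mem_iff_lt_rowLen]; omega
      exact μ.up_left_mem (by omega) le_rfl h2
    rw [e1, e2]
    exact fill_pos hT hmem
  · have e1 : etaFun n T a η m = m := by
      rw [etaFun]; exact if_neg (fun h' => h h'.2.2)
    have e2 : thetaFun (qaT n T a) (taT n T a) η (colIdx T m) = colIdx T m := if_neg h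
    rw [e1, e2]
    exact ⟨rfl, rfl⟩

lemma FTS_eta {n : ℕ} {μ : YoungDiagram} (hμ : μ.cells.card = n) {T : Tab}
    (hT : IsFilling μ T) (S : Tab) {w : Equiv.Perm ℕ} (hw : w ∈ etaSet n T) :
    rename (⇑w) (FTS n T S) = FTS n T S := by
  obtain ⟨a, ha, η, hη, hwe⟩ := hw
  have hsupp : SuppIn n w := by
    intro i hi
    rw [hwe, etaFun]
    exact if_neg (by omega)
  obtain ⟨ω, rfl⟩ := exists_emb n w hsupp
  have hspec := fun {m : ℕ} (hm : 1 ≤ m ∧ m ≤ n) => etaFun_spec hμ hT ha hη hm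
  rw [← hwe] at hspec
  apply FTS_norm
  · exact mem_row' fun i hi => (hspec hi).1
  · intro σ hσ
    refine mem_col' fun i hi => ?_
    have hk := emb_mem n ω⁻¹ hi
    rw [emb_mul, emb_mul, Equiv.Perm.mul_apply, Equiv.Perm.mul_apply,
      (hspec (emb_mem n σ hk)).2, (mem_col n T σ).1 hσ, ← (hspec hk).2, emb_inv]
    simp
  · intro σ hσ
    refine mem_col' fun i hi => ?_
    apply theta_inj (q := qaT n T a) hη
    have hk := emb_mem n (ω⁻¹ * σ * ω) hi
    rw [← (hspec hk).2, ← (hspec hi).2]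
    have : embedPerm n ω (embedPerm n (ω⁻¹ * σ * ω) i) = embedPerm n σ (embedPerm n ω i) := by
      rw [emb_mul, emb_mul, emb_inv]; simp
    rw [this, (mem_col n T σ).1 hσ]

/-- The classical Specht polynomial `F_T^{S⁰}` divides the higher Specht
polynomial `F_T^S`, and the quotient `Q_T^S` is a homogeneous polynomial with integer
coefficients that is invariant under every element of the extended column group `C̃(T)`. -/
theorem statement_10 (n : ℕ) (μ : YoungDiagram) (hμ : μ.cells.card = n) (S T : Tab)
    (hS : IsStandard μ S) (hT : IsFilling μ T) :
    FTS n T (rowWordTab μ) ≠ 0 ∧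
    ∃ Q : MvPolynomial ℕ ℚ,
      FTS n T S = FTS n T (rowWordTab μ) * Q ∧
      (∃ d, Q.IsHomogeneous d) ∧
      (∀ m : ℕ →₀ ℕ, ∃ z : ℤ, Q.coeff m = (z : ℚ)) ∧
      ∀ g ∈ extColSubgroup n T, rename (⇑g) Q = Q := by
  have hF0 : FTS n T (rowWordTab μ) ≠ 0 := by
    intro h
    have := coeff_F0 hμ hT
    rw [h] at this
    simp at this
  refine ⟨hF0, ?_⟩
  obtain ⟨q, hq⟩ := int_dvd (S := S) hμ hT
  refine ⟨map (Int.castRingHom ℚ) q, hq, ?_, ?_, ?_⟩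
  · apply homog_quot hF0 (FTS_homog n T (rowWordTab μ))
    rw [← hq]
    exact FTS_homog n T S
  · intro m
    exact ⟨coeff m q, by rw [coeff_map]; rfl⟩
  · intro g hg
    generalize map (Int.castRingHom ℚ) q = Q at hq
    induction hg using Subgroup.closure_induction with
    | mem w hw =>
      rcases hw with hw | hw
      · obtain ⟨π, rfl⟩ := exists_emb n w hw.1
        have hπ : π ∈ colFinset n T := mem_col' fun i hi => hw.2 i (Finset.mem_Icc.2 hi)
        have h1 := congrArg (rename (⇑(embedPerm n π))) hq
        rw [map_mul, FTS_col n T S hπ, FTS_col n T _ hπ, hq] at h1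
        rcases Int.units_eq_one_or (Equiv.Perm.sign π) with h | h
        · simp only [h, Units.val_one, one_smul] at h1
          exact (mul_left_cancel₀ hF0 h1).symm
        · simp only [h, Units.val_neg, Units.val_one, neg_smul, one_smul, neg_mul,
            neg_inj] at h1
          exact (mul_left_cancel₀ hF0 h1).symm
      · have h1 := congrArg (rename (⇑w)) hq
        rw [map_mul, FTS_eta hμ hT S hw, FTS_eta hμ hT _ hw, hq] at h1
        exact (mul_left_cancel₀ hF0 h1).symm
    | one => exact rename_id_apply Q
    | mul x y _ _ hx hy =>
      have : rename (⇑(x * y)) Q = rename (⇑x) (rename (⇑y) Q) := by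
        rw [rename_rename]; rfl
      rw [this, hy, hx]
    | inv x _ hx =>
      conv_lhs => rw [← hx]
      rw [rename_rename]
      have : (⇑x⁻¹ ∘ ⇑x) = id := by ext i; simp
      rw [this]
      exact rename_id_apply Q

end HigherSpecht
end
end

section
/- Let λ ⊢ n, T and S standard Young tableaux of shape λ, C a cocharge tableau of shape λ, and v an external corner of λ. Then: (i) Dsi(T+v) = Dsi(T) ∪ {n} if v lies below n in T, and Dsi(T+v) = Dsi(T) otherwise; (ii) Dsi^c(S+̃v) = Dsi^c(S) ∪ {n} if v lies below n in ev(S), and Dsi^c(S+̃v) = Dsi^c(S) otherwise; (iii) Dsp^c(C+̂v) = Dsp^c(C) ∪ {n} if v lies below n in ev(ct^{-1}(C)), and Dsp^c(C+̂v) = Dsp^c(C) otherwise; (iv) in the latter case of (iii), Σ(C+̂v) = Σ(C) and cc(S+̃v) = cc(S), while in the former case Σ(C+̂v) = Σ(C) + n and cc(S+̃v) = cc(S) + n; (v) in all cases, Dsi(T) = Dsi(T+v) ∩ {1,…,n−1}, Dsi^c(S) = Dsi^c(S+̃v) ∩ {1,…,n−1}, and Dsp^c(C) = Dsp^c(C+̂v)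 ∩ {1,…,n−1}. -/
open MvPolynomial

noncomputable section

namespace HigherSpecht

open scoped Classical

/-! ### Growth-path model of standard tableaux -/

/-- The cell on the right. -/
def rt (e : ℕ × ℕ) : ℕ × ℕ := (e.1, e.2 + 1)
/-- The cell below. -/
def dn (e : ℕ × ℕ) : ℕ × ℕ := (e.1 + 1, e.2)
/-- `p` is right of or below `e`. -/
def Adj (e p : ℕ × ℕ) : Prop := p = rt e ∨ p = dn e

/-- The tableau with entry `i + 1` at `P i` for `i < n`. -/
def tab : ℕ → (ℕ → ℕ × ℕ) → Tab
  | 0, _ => fun _ => 0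
  | n + 1, P => Function.update (tab n P) (P n) (n + 1)

/-- The shape of the first `k` steps. -/
def Lam (k : ℕ) (P : ℕ → ℕ × ℕ) : Set (ℕ × ℕ) := {c | ∃ j < k, P j = c}

/-- Lower sets of cells. -/
def Low (L : Set (ℕ × ℕ)) : Prop :=
  ∀ a b c d, (a, b) ∈ L → c ≤ a → d ≤ b → (c, d) ∈ L

/-- Valid growth paths. -/
def Valid (n : ℕ) (P : ℕ → ℕ × ℕ) : Prop :=
  ∀ k < n, P k ∉ Lam k P ∧ Low (Lam (k + 1) P)

/-- The moving hole. -/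
def eP (P : ℕ → ℕ × ℕ) : ℕ → ℕ × ℕ
  | 0 => P 0
  | k + 1 => if Adj (eP P k) (P (k + 1)) then P (k + 1) else eP P k

/-- The promoted path. -/
def qP (P : ℕ → ℕ × ℕ) (k : ℕ) : ℕ × ℕ :=
  if Adj (eP P k) (P (k + 1)) then eP P k else P (k + 1)

/-- The evacuated path. -/
def evP : ℕ → (ℕ → ℕ × ℕ) → ℕ → ℕ × ℕ
  | 0, P => P
  | m + 1, P => Function.update (evP m (qP P)) m (eP P m)

theorem Lam_succ (k : ℕ) (P : ℕ → ℕ × ℕ) : Lam (k + 1) P = insert (P k) (Lam k P) := by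
  ext c
  simp only [Lam, Set.mem_ofPred_eq, Set.mem_insert_iff]
  constructor
  · rintro ⟨j, hj, rfl⟩
    rcases Nat.lt_succ_iff_lt_or_eq.1 hj with h | h
    · exact Or.inr ⟨j, h, rfl⟩
    · left; rw [h]
  · rintro (rfl | ⟨j, hj, rfl⟩)
    · exact ⟨k, by omega, rfl⟩
    · exact ⟨j, by omega, rfl⟩

theorem Lam_zero (P : ℕ → ℕ × ℕ) : Lam 0 P = ∅ := by
  ext c; simp [Lam]

theorem Lam_congr {k : ℕ} {P P' : ℕ → ℕ × ℕ} (h : ∀ j < k, P j = P' j) : Lam k P = Lam k P' := by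
  ext c
  constructor
  · rintro ⟨j, hj, rfl⟩; exact ⟨j, hj, (h j hj).symm⟩
  · rintro ⟨j, hj, rfl⟩; exact ⟨j, hj, h j hj⟩

theorem Valid.congr {n : ℕ} {P P' : ℕ → ℕ × ℕ} (h : ∀ j < n, P j = P' j) (hP : Valid n P) :
    Valid n P' := by
  intro k hk
  rw [← Lam_congr (k := k) (P := P) (fun j hj => h j (by omega)),
    ← Lam_congr (k := k + 1) (P := P) (fun j hj => h j (by omega)), ← h k hk]
  exact hP k hk

theorem Valid.mono {n m : ℕ} {P : ℕ → ℕ × ℕ} (hP : Valid n P) (h : m ≤ n) : Valid m P :=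
  fun k hk => hP k (by omega)

theorem Valid.low {n k : ℕ} {P : ℕ → ℕ × ℕ} (hP : Valid n P) (h : k ≤ n) : Low (Lam k P) := by
  cases k with
  | zero => rw [Lam_zero]; intro a b c d h; exact h.elim
  | succ k => exact (hP k (by omega)).2

theorem Valid.inj {n : ℕ} {P : ℕ → ℕ × ℕ} (hP : Valid n P) {i j : ℕ} (hi : i < n) (hj : j < n)
    (h : P i = P j) : i = j := by
  rcases lt_trichotomy i j with h1 | h1 | h1
  · exact ((hP j hj).1 ⟨i, h1, h⟩).elim
  · exact h1
  · exact ((hP i hi).1 ⟨j, h1, h.symm⟩).elim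

theorem tab_congr {n : ℕ} {P P' : ℕ → ℕ × ℕ} (h : ∀ j < n, P j = P' j) : tab n P = tab n P' := by
  induction n with
  | zero => rfl
  | succ n ih => simp only [tab]; rw [ih (fun j hj => h j (by omega)), h n (by omega)]

theorem tab_eq_iff {n : ℕ} {P : ℕ → ℕ × ℕ} (hP : Valid n P) (c : ℕ × ℕ) (m : ℕ) :
    tab n P c = m + 1 ↔ m < n ∧ P m = c := by
  induction n with
  | zero => simp [tab]
  | succ n ih =>
    simp only [tab]
    by_cases hc : c = P n
    · subst hc
      rw [Function.update_self]
      constructor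
      · intro h
        have : m = n := by omega
        subst this
        exact ⟨by omega, rfl⟩
      · rintro ⟨h1, h2⟩
        rw [hP.inj h1 (by omega) h2]
    · rw [Function.update_of_ne hc, ih (hP.mono (by omega))]
      constructor
      · rintro ⟨h1, h2⟩; exact ⟨by omega, h2⟩
      · rintro ⟨h1, h2⟩
        refine ⟨?_, h2⟩
        rcases Nat.lt_succ_iff_lt_or_eq.1 h1 with h | h
        · exact h
        · subst h; exact (hc h2.symm).elim

theorem tab_apply {n : ℕ} {P : ℕ → ℕ × ℕ} (hP : Valid n P) {i : ℕ} (hi : i < n) :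
    tab n P (P i) = i + 1 := (tab_eq_iff hP _ _).2 ⟨hi, rfl⟩

theorem tab_zero_iff {n : ℕ} {P : ℕ → ℕ × ℕ} (hP : Valid n P) (c : ℕ × ℕ) :
    tab n P c = 0 ↔ c ∉ Lam n P := by
  constructor
  · rintro h ⟨j, hj, rfl⟩
    rw [tab_apply hP hj] at h; omega
  · intro h
    by_contra h0
    obtain ⟨m, hm⟩ := Nat.exists_eq_succ_of_ne_zero h0
    have := (tab_eq_iff hP c m).1 hm
    exact h ⟨m, this.1, this.2⟩

theorem tab_le (n : ℕ) (P : ℕ → ℕ × ℕ) (c : ℕ × ℕ) : tab n P c ≤ n := by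
  induction n with
  | zero => simp [tab]
  | succ n ih =>
    simp only [tab, Function.update_apply]
    split <;> omega

theorem rowIdx_tab {n : ℕ} {P : ℕ → ℕ × ℕ} (hP : Valid n P) {i : ℕ} (hi : i < n) :
    rowIdx (tab n P) (i + 1) = (P i).1 := by
  have : {r | ∃ c, tab n P (r, c) = i + 1} = {(P i).1} := by
    ext r
    simp only [Set.mem_ofPred_eq, Set.mem_singleton_iff]
    constructor
    · rintro ⟨c, hc⟩
      rw [((tab_eq_iff hP _ _).1 hc).2]
    · rintro rfl
      exact ⟨(P i).2, tab_apply hP hi⟩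
  rw [rowIdx, this, csInf_singleton]

theorem posOf_tab {n : ℕ} {P : ℕ → ℕ × ℕ} (hP : Valid n P) {i : ℕ} (hi : i < n) :
    posOf (tab n P) (i + 1) = P i := by
  have : {c | tab n P (rowIdx (tab n P) (i + 1), c) = i + 1} = {(P i).2} := by
    rw [rowIdx_tab hP hi]
    ext c
    simp only [Set.mem_ofPred_eq, Set.mem_singleton_iff]
    constructor
    · intro hc
      rw [((tab_eq_iff hP _ _).1 hc).2]
    · rintro rfl
      exact tab_apply hP hi
  rw [posOf, colIdx, this, csInf_singleton, rowIdx_tab hP hi]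

theorem Valid.first {n : ℕ} {P : ℕ → ℕ × ℕ} (hP : Valid n P) (h : 0 < n) : P 0 = (0, 0) := by
  have h1 := (hP 0 h).2
  rw [Lam_succ, Lam_zero] at h1
  have := h1 (P 0).1 (P 0).2 0 0 (by simp) (by omega) (by omega)
  simpa [eq_comm] using this

/-- Shape facts for the promotion. -/
theorem shape_q {n : ℕ} {P : ℕ → ℕ × ℕ} (hP : Valid n P) (k : ℕ) (hk : k < n) :
    eP P k ∈ Lam (k + 1) P ∧ Lam k (qP P) = Lam (k + 1) P \ {eP P k} ∧ Low (Lam k (qP P)) := by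
  induction k with
  | zero =>
    refine ⟨⟨0, by omega, rfl⟩, ?_, ?_⟩
    · rw [Lam_succ, Lam_zero, Lam_zero]; simp [eP]
    · rw [Lam_zero]; intro a b c d h; exact h.elim
  | succ k ih =>
    obtain ⟨h1, h2, h3⟩ := ih (by omega)
    have hp := (hP (k + 1) hk).1
    have hL := (hP (k + 1) hk).2
    have hL0 := (hP k (by omega)).2
    by_cases ha : Adj (eP P k) (P (k + 1))
    · have he : eP P (k + 1) = P (k + 1) := by simp [eP, ha]
      have hq : qP P k = eP P k := by simp [qP, ha]
      have : Lam (k + 1) (qP P) = Lam (k + 1) P := by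
        rw [Lam_succ, hq, h2]
        ext c
        simp only [Set.mem_insert_iff, Set.mem_sdiff, Set.mem_singleton_iff]
        constructor
        · rintro (rfl | h)
          · exact h1
          · exact h.1
        · intro h
          by_cases hc : c = eP P k
          · exact Or.inl hc
          · exact Or.inr ⟨h, hc⟩
      rw [he, this]
      refine ⟨⟨k + 1, by omega, rfl⟩, ?_, hL0⟩
      rw [Lam_succ (k + 1)]
      ext c
      simp only [Set.mem_insert_iff, Set.mem_sdiff, Set.mem_singleton_iff]
      constructor
      · intro h
        refine ⟨Or.inr h, ?_⟩
        rintro rfl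
        exact hp h
      · rintro ⟨h | h, h'⟩
        · exact (h' h).elim
        · exact h
    · have he : eP P (k + 1) = eP P k := by simp [eP, ha]
      have hq : qP P k = P (k + 1) := by simp [qP, ha]
      have hne : P (k + 1) ≠ eP P k := by
        intro h; rw [h] at hp; exact hp h1
      have h5 : Lam (k + 1) (qP P) = Lam (k + 1 + 1) P \ {eP P k} := by
        rw [Lam_succ, hq, h2, Lam_succ (k + 1)]
        ext c
        simp only [Set.mem_insert_iff, Set.mem_sdiff, Set.mem_singleton_iff]
        constructor
        · rintro (rfl | h)
          · exact ⟨Or.inl rfl, hne⟩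
          · exact ⟨Or.inr h.1, h.2⟩
        · rintro ⟨h | h, h'⟩
          · exact Or.inl h
          · exact Or.inr ⟨h, h'⟩
      rw [he]
      refine ⟨?_, h5, ?_⟩
      · rw [Lam_succ]; exact Or.inr h1
      · rw [h5]
        intro a b c d hab hca hdb
        refine ⟨hL a b c d hab.1 hca hdb, ?_⟩
        intro hcd
        rw [Set.mem_singleton_iff] at hcd
        -- (c,d) = e ; (a,b) in shape
        have key : ∀ x, x ∈ Lam (k + 1 + 1) P → x ≠ P (k + 1) → c ≤ x.1 → d ≤ x.2 →
            x ≠ (c, d) → False := by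
          intro x hx hxp hx1 hx2 hx3
          have hx' : x ∈ Lam k (qP P) := by
            rw [h2]
            rw [Lam_succ] at hx
            refine ⟨hx.resolve_left hxp, ?_⟩
            rw [← hcd]; exact hx3
          have := h3 x.1 x.2 c d hx' hx1 hx2
          rw [h2, hcd] at this
          exact this.2 rfl
        by_cases hpab : (a, b) = P (k + 1)
        · have hr : (a, b) ≠ rt (c, d) := by
            rw [hpab, hcd]; intro h; exact ha (Or.inl h)
          have hd : (a, b) ≠ dn (c, d) := by
            rw [hpab, hcd]; intro h; exact ha (Or.inr h)
          have h0 : (a, b) ≠ (c, d) := by rw [hpab, hcd]; exact hne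
          simp only [rt, dn, ne_eq, Prod.mk.injEq] at hr hd h0
          by_cases hdb' : d + 1 ≤ b
          · refine key (c, d + 1) (hL a b _ _ hab.1 hca hdb') ?_ le_rfl (by simp) (by simp)
            rw [← hpab]; intro h; simp only [Prod.mk.injEq] at h; omega
          · refine key (c + 1, d) (hL a b _ _ hab.1 (by omega) hdb) ?_ (by simp) le_rfl (by simp)
            rw [← hpab]; intro h; simp only [Prod.mk.injEq] at h; omega
        · refine key (a, b) hab.1 hpab hca hdb ?_
          intro h
          exact hab.2 (by rw [h, hcd]; rfl)

theorem valid_q {n : ℕ} {P : ℕ → ℕ × ℕ} (hP : Valid (n + 1) P) : Valid n (qP P) := by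
  intro k hk
  obtain ⟨h1, h2, h3⟩ := shape_q hP k (by omega)
  refine ⟨?_, (shape_q hP (k + 1) (by omega)).2.2⟩
  rw [h2]
  by_cases ha : Adj (eP P k) (P (k + 1))
  · simp [qP, ha]
  · simp only [qP, ha, if_false]
    intro h
    exact (hP (k + 1) (by omega)).1 h.1

/-- Shape facts for evacuation. -/
theorem valid_ev (n : ℕ) (P : ℕ → ℕ × ℕ) (hP : Valid n P) :
    Valid n (evP n P) ∧ Lam n (evP n P) = Lam n P := by
  induction n generalizing P with
  | zero => exact ⟨fun k hk => by omega, by rw [Lam_zero, Lam_zero]⟩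
  | succ m ih =>
    obtain ⟨h1, h2⟩ := ih (qP P) (valid_q hP)
    obtain ⟨s1, s2, s3⟩ := shape_q hP m (by omega)
    have hc : ∀ j < m, evP m (qP P) j = evP (m + 1) P j := by
      intro j hj
      simp only [evP]
      rw [Function.update_of_ne (by omega)]
    have hm : evP (m + 1) P m = eP P m := by simp [evP]
    have hl : Lam m (evP (m + 1) P) = Lam (m + 1) P \ {eP P m} := by
      rw [← Lam_congr hc, h2, s2]
    have hl' : Lam (m + 1) (evP (m + 1) P) = Lam (m + 1) P := by
      rw [Lam_succ, hl, hm]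
      ext c
      simp only [Set.mem_insert_iff, Set.mem_sdiff, Set.mem_singleton_iff]
      constructor
      · rintro (rfl | h)
        · exact s1
        · exact h.1
      · intro h
        by_cases hc : c = eP P m
        · exact Or.inl hc
        · exact Or.inr ⟨h, hc⟩
    refine ⟨?_, hl'⟩
    intro k hk
    rcases Nat.lt_succ_iff_lt_or_eq.1 hk with h | h
    · exact (h1.congr hc) k h
    · subst h
      rw [hl', hl, hm]
      exact ⟨fun h => h.2 rfl, (hP k hk).2⟩

/-! ### Sliding -/

theorem slide_stuck {T : Tab} {h p : ℕ × ℕ} {M : ℕ} (K : ℕ) (hM : 0 < M)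
    (hp : T p = 0) (hpr : T (rt p) = 0) (hpd : T (dn p) = 0)
    (t1 : T (rt h) = 0) (t2 : T (dn h) = 0) (hph : p ≠ h) :
    slide (K + 1) (Function.update T p M) h =
      if Adj h p then (Function.update T h M, p) else (Function.update T p M, h) := by
  obtain ⟨r, c⟩ := h
  simp only [rt, dn] at *
  have stuck : ∀ (K : ℕ) (U : Tab) (x : ℕ × ℕ), U (x.1, x.2 + 1) = 0 → U (x.1 + 1, x.2) = 0 →
      slide K U x = (U, x) := by
    intro K U x h1 h2
    cases K with
    | zero => rfl
    | succ K => simp [slide, slideOnce, h1, h2]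
  by_cases ha : Adj (r, c) p
  · rw [if_pos ha]
    have hfin : Function.update (Function.update (Function.update T p M) (r, c) M) p 0
        = Function.update T (r, c) M := by
      funext x
      simp only [Function.update_apply]
      split_ifs with h1 h2 h2
      · exact (hph (h1.symm.trans h2)).elim
      · rw [h1, hp]
      · rfl
      · rfl
    have e1 : slideOnce (Function.update T p M) (r, c) = (Function.update T (r, c) M, p) := by
      rw [← hfin]
      rcases ha with ha | ha
      · simp only [rt] at ha
        subst ha
        have : ((r + 1, c) : ℕ × ℕ) ≠ (r, c + 1) := by simp
        simp [slideOnce, t2, hM.ne']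
      · simp only [dn] at ha
        subst ha
        simp [slideOnce, t1, hM.ne']
    simp only [slide, e1, hph, if_false]
    apply stuck
    · rw [Function.update_of_ne, hpr]
      rcases ha with ha | ha <;> simp [ha, rt, dn] <;> omega
    · rw [Function.update_of_ne, hpd]
      rcases ha with ha | ha <;> simp [ha, rt, dn] <;> omega
  · rw [if_neg ha]
    apply stuck
    · rw [Function.update_of_ne, t1]
      intro h; exact ha (Or.inl h.symm)
    · rw [Function.update_of_ne, t2]
      intro h; exact ha (Or.inr h.symm)

theorem slideOnce_rt {T : Tab} {h : ℕ × ℕ} (hr : T (rt h) ≠ 0)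
    (hc : T (dn h) = 0 ∨ T (rt h) < T (dn h)) :
    slideOnce T h = (Function.update (Function.update T h (T (rt h))) (rt h) 0, rt h) := by
  simp only [rt, dn] at *
  simp only [slideOnce]
  rw [if_neg (by tauto), if_pos (by tauto)]

theorem slideOnce_dn {T : Tab} {h : ℕ × ℕ} (hd : T (dn h) ≠ 0)
    (hc : T (rt h) = 0 ∨ ¬ T (rt h) < T (dn h)) :
    slideOnce T h = (Function.update (Function.update T h (T (dn h))) (dn h) 0, dn h) := by
  simp only [rt, dn] at *
  simp only [slideOnce]
  rw [if_neg (by tauto), if_neg (by tauto)]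

theorem slide_max (K : ℕ) (T : Tab) (h p : ℕ × ℕ) (M : ℕ) (hM : ∀ c, T c < M)
    (hp : T p = 0) (hpr : T (rt p) = 0) (hpd : T (dn p) = 0) (hph : p ≠ h)
    (hrh : rt p ≠ h) (hdh : dn p ≠ h) (T' : Tab) (e : ℕ × ℕ) (hs : slide K T h = (T', e))
    (t1 : T' (rt e) = 0) (t2 : T' (dn e) = 0) :
    slide (K + 1) (Function.update T p M) h =
      if Adj e p then (Function.update T' e M, p) else (Function.update T' p M, e) := by
  have hM0 : 0 < M := lt_of_le_of_lt (Nat.zero_le _) (hM p)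
  induction K generalizing T h with
  | zero =>
    simp only [slide, Prod.mk.injEq] at hs
    obtain ⟨rfl, rfl⟩ := hs
    exact slide_stuck 0 hM0 hp hpr hpd t1 t2 hph
  | succ K ih =>
    by_cases hst : T (rt h) = 0 ∧ T (dn h) = 0
    · have : slide (K + 1) T h = (T, h) := by
        simp only [rt, dn] at hst
        simp [slide, slideOnce, hst]
      rw [this, Prod.mk.injEq] at hs
      obtain ⟨rfl, rfl⟩ := hs
      exact slide_stuck (K + 1) hM0 hp hpr hpd t1 t2 hph
    · -- the step goes to a neighbour `g`
      have step : ∃ g, (g = rt h ∨ g = dn h) ∧ T g ≠ 0 ∧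
          slideOnce T h = (Function.update (Function.update T h (T g)) g 0, g) ∧
          slideOnce (Function.update T p M) h =
            (Function.update (Function.update (Function.update T p M) h (T g)) g 0, g) := by
        have hup : ∀ x, T x ≠ 0 → Function.update T p M x = T x := by
          intro x hx
          rw [Function.update_of_ne]
          rintro rfl; exact hx hp
        have hup0 : ∀ x, T x = 0 → Function.update T p M x = 0 ∨ Function.update T p M x = M := by
          intro x hx
          rw [Function.update_apply]
          split
          · exact Or.inr rfl
          · exact Or.inl hx
        by_cases hc : T (dn h) = 0 ∨ (T (rt h) ≠ 0 ∧ T (rt h) < T (dn h))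
        · have hr : T (rt h) ≠ 0 := by tauto
          refine ⟨rt h, Or.inl rfl, hr, ?_, ?_⟩
          · exact slideOnce_rt hr (by tauto)
          · rw [slideOnce_rt (by rw [hup _ hr]; exact hr), hup _ hr]
            rw [hup _ hr]
            by_cases hd : T (dn h) = 0
            · rcases hup0 _ hd with h1 | h1
              · exact Or.inl h1
              · right; rw [h1]; exact hM _
            · rw [hup _ hd]; tauto
        · have hd : T (dn h) ≠ 0 := by tauto
          refine ⟨dn h, Or.inr rfl, hd, ?_, ?_⟩
          · exact slideOnce_dn hd (by tauto)
          · rw [slideOnce_dn (by rw [hup _ hd]; exact hd), hup _ hd]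
            rw [hup _ hd]
            by_cases hr : T (rt h) = 0
            · rcases hup0 _ hr with h1 | h1
              · exact Or.inl h1
              · right; rw [h1]; have := hM (dn h); omega
            · rw [hup _ hr]; tauto
      obtain ⟨g, hg, hg0, s1, s2⟩ := step
      have hgh : g ≠ h := by
        rcases hg with rfl | rfl <;> intro h' <;> simp [rt, dn, Prod.ext_iff] at h'
      have hpg : p ≠ g := by rintro rfl; exact hg0 hp
      have hrg : rt p ≠ g := by rintro rfl; exact hg0 hpr
      have hdg : dn p ≠ g := by rintro rfl; exact hg0 hpd
      have hcomm : Function.update (Function.update (Function.update T p M) h (T g)) g 0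
          = Function.update (Function.update (Function.update T h (T g)) g 0) p M := by
        rw [Function.update_comm hph, Function.update_comm hpg]
      have e1 : slide (K + 1) T h =
          slide K (Function.update (Function.update T h (T g)) g 0) g := by
        simp only [slide, s1, hgh, if_false]
      have e2 : slide (K + 1 + 1) (Function.update T p M) h =
          slide (K + 1) (Function.update (Function.update (Function.update T h (T g)) g 0) p M)
            g := by
        rw [← hcomm, slide]
        simp only [s2, hgh, if_false]
      rw [e2]
      refine ih _ g ?_ ?_ ?_ ?_ hpg hrg hdg (e1 ▸ hs)
      · intro c
        simp only [Function.update_apply]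
        split_ifs
        · exact hM0
        · exact hM _
        · exact hM _
      · rw [Function.update_of_ne hpg, Function.update_of_ne hph, hp]
      · rw [Function.update_of_ne hrg, Function.update_of_ne hrh, hpr]
      · rw [Function.update_of_ne hdg, Function.update_of_ne hdh, hpd]

/-- Shift the nonzero entries by one. -/
def sh (T : Tab) : Tab := fun c => if T c = 0 then 0 else T c + 1

theorem sh_update (T : Tab) (p : ℕ × ℕ) (n : ℕ) :
    sh (Function.update T p (n + 1)) = Function.update (sh T) p (n + 2) := by
  funext x
  simp only [sh, Function.update_apply]
  split_ifs <;> simp_all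

theorem slide_tab (n : ℕ) (P : ℕ → ℕ × ℕ) (hP : Valid (n + 1) P) :
    slide (n + 1) (Function.update (tab (n + 1) P) (P 0) 0) (P 0) = (sh (tab n (qP P)), eP P n) := by
  induction n with
  | zero =>
    have : Function.update (tab (0 + 1) P) (P 0) 0 = fun _ => 0 := by
      simp only [tab, Function.update_idem]
      funext x; simp [Function.update_apply]
    rw [this]
    have h2 : sh (tab 0 (qP P)) = fun _ => 0 := by funext x; simp [sh, tab]
    rw [h2]
    simp [slide, slideOnce, eP]
  | succ n ih =>
    have hP' : Valid (n + 1) P := hP.mono (by omega)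
    have ih := ih hP'
    obtain ⟨s1, s2, s3⟩ := shape_q hP n (by omega)
    have hq : Valid n (qP P) := valid_q hP'
    have hlow := (hP n (by omega)).2
    have hp := (hP (n + 1) (by omega)).1
    have hp0 : P (n + 1) ≠ P 0 := by
      intro h; have := hP.inj (by omega) (by omega) h; omega
    have hpr : rt (P (n + 1)) ∉ Lam (n + 1) P := by
      intro h; exact hp (hlow _ _ _ _ h le_rfl (by simp))
    have hpd : dn (P (n + 1)) ∉ Lam (n + 1) P := by
      intro h; exact hp (hlow _ _ _ _ h (by simp) le_rfl)
    have hU : ∀ x, x ∉ Lam (n + 1) P →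
        Function.update (tab (n + 1) P) (P 0) 0 x = 0 := by
      intro x hx
      rw [Function.update_apply]
      split
      · rfl
      · exact (tab_zero_iff hP' x).2 hx
    have h00 : P 0 ∈ Lam (n + 1) P := ⟨0, by omega, rfl⟩
    have hcomm : Function.update (tab (n + 1 + 1) P) (P 0) 0 =
        Function.update (Function.update (tab (n + 1) P) (P 0) 0) (P (n + 1)) (n + 2) := by
      rw [tab, Function.update_comm hp0]
    rw [hcomm]
    have hsz : ∀ x, x ∉ Lam n (qP P) → sh (tab n (qP P)) x = 0 := by
      intro x hx
      simp [sh, (tab_zero_iff hq x).2 hx]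
    have hen : eP P n ∉ Lam n (qP P) := by rw [s2]; exact fun h => h.2 rfl
    rw [slide_max (n + 1) _ (P 0) (P (n + 1)) (n + 2) ?_ (hU _ hp) (hU _ hpr) (hU _ hpd) hp0
      (by intro h; rw [h] at hpr; exact hpr h00) (by intro h; rw [h] at hpd; exact hpd h00)
      _ _ ih (hsz _ ?_) (hsz _ ?_)]
    · by_cases ha : Adj (eP P n) (P (n + 1))
      · rw [if_pos ha, tab, sh_update]
        simp [eP, qP, ha]
      · rw [if_neg ha, tab, sh_update]
        simp [eP, qP, ha]
    · intro c
      rw [Function.update_apply]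
      split
      · omega
      · have := tab_le (n + 1) P c; omega
    · intro h; exact hen (s3 _ _ _ _ h le_rfl (by simp))
    · intro h; exact hen (s3 _ _ _ _ h (by simp) le_rfl)

theorem evac_tab (n : ℕ) (P : ℕ → ℕ × ℕ) (hP : Valid n P) :
    evac n (tab n P) = tab n (evP n P) := by
  unfold evac
  induction n generalizing P with
  | zero => rfl
  | succ m ih =>
    have hpos : posOf (tab (m + 1) P) 1 = P 0 := posOf_tab hP (by omega)
    have hsh : (fun c => sh (tab m (qP P)) c - 1) = tab m (qP P) := by
      funext c; simp only [sh]; split <;> omega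
    simp only [evacAux, hpos, slide_tab m P hP, hsh]
    rw [ih _ (valid_q hP), tab]
    have : evP (m + 1) P m = eP P m := by simp [evP]
    rw [this]
    congr 1
    apply tab_congr
    intro j hj
    simp only [evP]
    rw [Function.update_of_ne (by omega)]

/-! ### Descents of promotion and evacuation -/

theorem local_desc (M : ℕ → ℕ → Prop) (a b c d f g : ℕ)
    (F0 : M a b) (F0' : ¬ M c d) (FL : ∀ x y z w, M x y → z ≤ x → w ≤ y → M z w)
    (F1 : ∀ x y, M x y → a ≤ x → b ≤ y → x = a ∧ y = b)
    (F2 : ∀ x y, x ≤ c → y ≤ d → M x y ∨ (x = c ∧ y = d))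
    (F3 : ∀ x y, x ≤ f → y ≤ g → M x y ∨ (x = c ∧ y = d) ∨ (x = f ∧ y = g))
    (F4 : ¬ (f ≤ c ∧ g ≤ d)) :
    -- p adjacent to e
    ((c = a ∧ d = b + 1) ∨ (c = a + 1 ∧ d = b) →
      (((f = c ∧ g = d + 1) ∨ (f = c + 1 ∧ g = d) → (a < c ↔ c < f)) ∧
       (¬ ((f = c ∧ g = d + 1) ∨ (f = c + 1 ∧ g = d)) → (a < f ↔ c < f)))) ∧
    (¬ ((c = a ∧ d = b + 1) ∨ (c = a + 1 ∧ d = b)) →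
      (((f = a ∧ g = b + 1) ∨ (f = a + 1 ∧ g = b) → (c < a ↔ c < f)))) := by
  refine ⟨?_, ?_⟩
  · rintro (⟨rfl, rfl⟩ | ⟨rfl, rfl⟩)
    · refine ⟨?_, fun _ => Iff.rfl⟩
      rintro (⟨rfl, rfl⟩ | ⟨rfl, rfl⟩)
      · omega
      · rcases F3 (c + 1) b le_rfl (by omega) with h | h | h
        · have := F1 _ _ h (by omega) (by omega); omega
        · omega
        · omega
    · refine ⟨?_, ?_⟩
      · rintro (⟨rfl, rfl⟩ | ⟨rfl, rfl⟩)
        · rcases F3 a (d + 1) (by omega) (by omega) with h | h | h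
          · have := F1 _ _ h (by omega) (by omega); omega
          · omega
          · omega
        · omega
      · intro hn
        constructor
        · intro h
          by_contra h2
          have hf : f = a + 1 := by omega
          have hg : d + 1 < g := by omega
          rcases F3 (a + 1) (d + 1) (by omega) (by omega) with h | h | h
          · have := F1 _ _ h (by omega) (by omega); omega
          · omega
          · omega
        · omega
  · intro hn
    rintro (⟨rfl, rfl⟩ | ⟨rfl, rfl⟩)
    · exact Iff.rfl
    · constructor
      · omega
      · intro h
        by_contra h2
        have hc : c = a := by omega
        subst hc
        by_cases hd : d ≤ g
        · exact F0' (FL _ _ _ _ F0 le_rfl hd)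
        · rcases F2 c (g + 1) le_rfl (by omega) with h | h
          · have := F1 _ _ h (by omega) (by omega); omega
          · omega

theorem desc_q {n : ℕ} {P : ℕ → ℕ × ℕ} (hP : Valid n P) {k : ℕ} (hk : k + 2 < n) :
    (qP P k).1 < (qP P (k + 1)).1 ↔ (P (k + 1)).1 < (P (k + 2)).1 := by
  obtain ⟨s1, s2, s3⟩ := shape_q hP k (by omega)
  have hL := (hP k (by omega)).2
  have hp := (hP (k + 1) (by omega)).1
  have hpL := (hP (k + 1) (by omega)).2
  have hr := (hP (k + 2) (by omega)).1
  have hrL := (hP (k + 2) (by omega)).2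
  have key := local_desc (fun x y => (x, y) ∈ Lam (k + 1) P) (eP P k).1 (eP P k).2
    (P (k + 1)).1 (P (k + 1)).2 (P (k + 2)).1 (P (k + 2)).2 s1 hp hL
    (by
      intro x y h1 h2 h3
      by_contra h4
      have h5 : (x, y) ∈ Lam k (qP P) := by
        rw [s2]; refine ⟨h1, ?_⟩
        rw [Set.mem_singleton_iff, Prod.ext_iff]; exact h4
      have := s3 _ _ _ _ h5 h2 h3
      rw [s2] at this
      exact this.2 rfl)
    (by
      intro x y h1 h2
      have := hpL (P (k + 1)).1 (P (k + 1)).2 x y ⟨k + 1, by omega, rfl⟩ h1 h2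
      rw [Lam_succ, Set.mem_insert_iff, Prod.ext_iff] at this
      exact this.symm)
    (by
      intro x y h1 h2
      have := hrL (P (k + 2)).1 (P (k + 2)).2 x y ⟨k + 2, by omega, rfl⟩ h1 h2
      rw [Lam_succ, Set.mem_insert_iff, Lam_succ, Set.mem_insert_iff, Prod.ext_iff,
        Prod.ext_iff] at this
      tauto)
    (by
      rintro ⟨h1, h2⟩
      exact hr (hpL (P (k + 1)).1 (P (k + 1)).2 _ _ ⟨k + 1, by omega, rfl⟩ h1 h2))
  have hadj : ∀ e p : ℕ × ℕ, Adj e p ↔ (p.1 = e.1 ∧ p.2 = e.2 + 1) ∨ (p.1 = e.1 + 1 ∧ p.2 = e.2) := by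
    intro e p; simp [Adj, rt, dn, Prod.ext_iff]
  simp only [← hadj] at key
  by_cases h1 : Adj (eP P k) (P (k + 1))
  · have e1 : qP P k = eP P k := by simp [qP, h1]
    have e2 : eP P (k + 1) = P (k + 1) := by simp [eP, h1]
    rw [e1, qP, e2]
    by_cases h2 : Adj (P (k + 1)) (P (k + 2))
    · rw [if_pos h2]; exact (key.1 h1).1 h2
    · rw [if_neg h2]; exact (key.1 h1).2 h2
  · have e1 : qP P k = P (k + 1) := by simp [qP, h1]
    have e2 : eP P (k + 1) = eP P k := by simp [eP, h1]
    rw [e1, qP, e2]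
    by_cases h2 : Adj (eP P k) (P (k + 2))
    · rw [if_pos h2]; exact key.2 h1 h2
    · rw [if_neg h2]

theorem local_holes (M : ℕ → ℕ → Prop) (a b c d x y : ℕ)
    (hp : ¬ M x y) (FL : ∀ x y z w, M x y → z ≤ x → w ≤ y → M z w)
    (E0 : M a b) (F0 : M c d)
    (G1 : ∀ u v, M u v → a ≤ u → b ≤ v → u = a ∧ v = b)
    (G2 : ∀ u v, M u v → c ≤ u → d ≤ v → (u = a ∧ v = b) ∨ (u = c ∧ v = d))
    (G3 : ∀ u v, u ≤ x → v ≤ y → M u v ∨ (u = x ∧ v = y))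
    (I1 : a ≤ c) (I2 : d < b) :
    -- `p = (x, y)`, `e = (a, b)`, `f = (c, d)`
    ((x = a ∧ y = b + 1) ∨ (x = a + 1 ∧ y = b) →
      (((a = c ∧ b = d + 1) ∨ (a = c + 1 ∧ b = d) → x ≤ a ∧ b < y) ∧
       (¬ ((a = c ∧ b = d + 1) ∨ (a = c + 1 ∧ b = d)) → x ≤ c ∧ d < y))) ∧
    (¬ ((x = a ∧ y = b + 1) ∨ (x = a + 1 ∧ y = b)) →
      ((x = c ∧ y = d + 1) ∨ (x = c + 1 ∧ y = d) → a ≤ x ∧ y < b)) := by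
  refine ⟨?_, ?_⟩
  · rintro (⟨rfl, rfl⟩ | ⟨rfl, rfl⟩)
    · omega
    · by_cases hac : a = c
      · subst hac
        exfalso
        rcases G3 (a + 1) d le_rfl (by omega) with h | h
        · rcases G2 _ _ h (by omega) (by omega) with h | h <;> omega
        · omega
      · omega
  · rintro hn (⟨rfl, rfl⟩ | ⟨rfl, rfl⟩)
    · refine ⟨I1, ?_⟩
      by_contra hb
      have hb' : b = d + 1 := by omega
      subst hb'
      have hax : a ≠ x := by rintro rfl; exact hp E0
      rcases G3 (a + 1) (d + 1) (by omega) (by omega) with h | h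
      · have := G1 _ _ h (by omega) (by omega); omega
      · omega
    · omega

/-- The two-hole configuration satisfies the hypotheses of `local_holes`. -/
theorem holes_facts {n : ℕ} {P : ℕ → ℕ × ℕ} (hP : Valid n P) {k : ℕ} (hk : k + 2 < n) :
    let M : ℕ → ℕ → Prop := fun x y => (x, y) ∈ Lam (k + 2) P
    let e := eP P (k + 1)
    let f := eP (qP P) k
    let p := P (k + 2)
    ¬ M p.1 p.2 ∧ (∀ x y z w, M x y → z ≤ x → w ≤ y → M z w) ∧ M e.1 e.2 ∧ M f.1 f.2 ∧
    (∀ u v, M u v → e.1 ≤ u → e.2 ≤ v → u = e.1 ∧ v = e.2) ∧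
    (∀ u v, M u v → f.1 ≤ u → f.2 ≤ v → (u = e.1 ∧ v = e.2) ∨ (u = f.1 ∧ v = f.2)) ∧
    (∀ u v, u ≤ p.1 → v ≤ p.2 → M u v ∨ (u = p.1 ∧ v = p.2)) := by
  intro M e f p
  obtain ⟨s1, s2, s3⟩ := shape_q hP (k + 1) (by omega)
  have hQ : Valid (n - 1) (qP P) := valid_q (by rwa [Nat.sub_add_cancel (by omega)])
  obtain ⟨q1, q2, q3⟩ := shape_q hQ k (by omega)
  have hpL := (hP (k + 2) (by omega)).2
  refine ⟨(hP (k + 2) (by omega)).1, (hP (k + 1) (by omega)).2, s1, ?_, ?_, ?_, ?_⟩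
  · rw [s2] at q1; exact q1.1
  · intro x y h1 h2 h3
    by_contra h4
    have h5 : (x, y) ∈ Lam (k + 1) (qP P) := by
      rw [s2]; refine ⟨h1, ?_⟩
      rw [Set.mem_singleton_iff, Prod.ext_iff]; exact h4
    have := s3 _ _ _ _ h5 h2 h3
    rw [s2] at this
    exact this.2 rfl
  · intro x y h1 h2 h3
    by_contra h4
    rw [not_or] at h4
    have h5 : (x, y) ∈ Lam (k + 1) (qP P) := by
      rw [s2]; refine ⟨h1, ?_⟩
      rw [Set.mem_singleton_iff, Prod.ext_iff]; exact h4.1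
    have h6 : (x, y) ∈ Lam k (qP (qP P)) := by
      rw [q2]; refine ⟨h5, ?_⟩
      rw [Set.mem_singleton_iff, Prod.ext_iff]; exact h4.2
    have := q3 _ _ _ _ h6 h2 h3
    rw [q2] at this
    exact this.2 rfl
  · intro x y h1 h2
    have := hpL (P (k + 2)).1 (P (k + 2)).2 x y ⟨k + 2, by omega, rfl⟩ h1 h2
    rw [Lam_succ, Set.mem_insert_iff, Prod.ext_iff] at this
    exact this.symm

theorem adj_iff (e p : ℕ × ℕ) :
    Adj e p ↔ (p.1 = e.1 ∧ p.2 = e.2 + 1) ∨ (p.1 = e.1 + 1 ∧ p.2 = e.2) := by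
  simp [Adj, rt, dn, Prod.ext_iff]

theorem adj_iff' (e p : ℕ × ℕ) :
    Adj e p ↔ (p.2 = e.2 ∧ p.1 = e.1 + 1) ∨ (p.2 = e.2 + 1 ∧ p.1 = e.1) := by
  rw [adj_iff]; tauto

theorem holes_step {e f p : ℕ × ℕ} (R : ℕ × ℕ → ℕ × ℕ → Prop) (h0 : R e f)
    (key : (Adj e p → (Adj f e → R p e) ∧ (¬ Adj f e → R p f)) ∧
      (¬ Adj e p → Adj f p → R e p)) :
    R (if Adj e p then p else e)
      (if Adj f (if Adj e p then e else p) then (if Adj e p then e else p) else f) := by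
  by_cases h1 : Adj e p
  · simp only [h1, if_true]
    by_cases h2 : Adj f e
    · simp only [h2, if_true]; exact (key.1 h1).1 h2
    · simp only [h2, if_false]; exact (key.1 h1).2 h2
  · simp only [h1, if_false]
    by_cases h2 : Adj f p
    · simp only [h2, if_true]; exact key.2 h1 h2
    · simp only [h2, if_false]; exact h0

theorem holes_right {n : ℕ} {P : ℕ → ℕ × ℕ} (hP : Valid n P) (h1 : P 1 = (0, 1)) (k : ℕ)
    (hk : k + 1 < n) :
    (eP P (k + 1)).1 ≤ (eP (qP P) k).1 ∧ (eP (qP P) k).2 < (eP P (k + 1)).2 := by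
  induction k with
  | zero =>
    have h0 := hP.first (by omega)
    have : Adj (P 0) (P 1) := by rw [h0, h1]; exact Or.inl rfl
    rw [h0, h1] at this
    simp [eP, qP, this, h0, h1]
  | succ k ih =>
    have ih := ih (by omega)
    obtain ⟨g1, g2, g3, g4, g5, g6, g7⟩ := holes_facts hP (k := k) (by omega)
    have key := local_holes _ _ _ _ _ _ _ g1 g2 g3 g4 g5 g6 g7 ih.1 ih.2
    simp only [← adj_iff] at key
    exact holes_step (fun a b => a.1 ≤ b.1 ∧ b.2 < a.2) ih key

theorem holes_down {n : ℕ} {P : ℕ → ℕ × ℕ} (hP : Valid n P) (h1 : P 1 = (1, 0)) (k : ℕ)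
    (hk : k + 1 < n) :
    (eP P (k + 1)).2 ≤ (eP (qP P) k).2 ∧ (eP (qP P) k).1 < (eP P (k + 1)).1 := by
  induction k with
  | zero =>
    have h0 := hP.first (by omega)
    have : Adj (P 0) (P 1) := by rw [h0, h1]; exact Or.inr rfl
    rw [h0, h1] at this
    simp [eP, qP, this, h0, h1]
  | succ k ih =>
    have ih := ih (by omega)
    obtain ⟨g1, g2, g3, g4, g5, g6, g7⟩ := holes_facts hP (k := k) (by omega)
    have key := local_holes (fun x y => (y, x) ∈ Lam (k + 2) P) _ _ _ _ _ _ g1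
      (fun x y z w h h1 h2 => g2 y x w z h h2 h1) g3 g4
      (fun u v h h1 h2 => (g5 v u h h2 h1).symm)
      (fun u v h h1 h2 => (g6 v u h h2 h1).imp And.symm And.symm)
      (fun u v h1 h2 => (g7 v u h2 h1).imp id And.symm) ih.1 ih.2
    simp only [← adj_iff'] at key
    exact holes_step (fun a b => a.2 ≤ b.2 ∧ b.1 < a.1) ih key

theorem Valid.second {n : ℕ} {P : ℕ → ℕ × ℕ} (hP : Valid n P) (h : 1 < n) :
    P 1 = (0, 1) ∨ P 1 = (1, 0) := by
  have h0 := hP.first (by omega)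
  have h1 := (hP 1 h).1
  have h2 := (hP 1 h).2
  rw [Lam_succ, Lam_zero] at h1
  rw [Lam_succ, Lam_succ, Lam_zero] at h2
  rw [h0] at h1 h2
  have h3 : ∀ x y, x ≤ (P 1).1 → y ≤ (P 1).2 → (x = (P 1).1 ∧ y = (P 1).2) ∨ (x = 0 ∧ y = 0) := by
    intro x y hx hy
    have := h2 (P 1).1 (P 1).2 x y (by simp) hx hy
    simpa [Prod.ext_iff] using this
  simp only [Prod.ext_iff]
  have h4 : ¬ ((P 1).1 = 0 ∧ (P 1).2 = 0) := by simpa [Prod.ext_iff] using h1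
  by_cases ha : (P 1).1 = 0
  · have := h3 0 1 (by omega) (by omega); omega
  · have := h3 1 0 (by omega) (by omega); omega

theorem desc_ev (n : ℕ) (P : ℕ → ℕ × ℕ) (hP : Valid n P) (i : ℕ) (hi : 0 < i) (hin : i < n) :
    (evP n P (i - 1)).1 < (evP n P i).1 ↔ (P (n - i - 1)).1 < (P (n - i)).1 := by
  induction n generalizing P with
  | zero => omega
  | succ m ih =>
    rcases Nat.lt_succ_iff_lt_or_eq.1 hin with h | h
    · simp only [evP]
      rw [Function.update_of_ne (by omega), Function.update_of_ne (by omega),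
        ih (qP P) (valid_q hP) h]
      obtain ⟨t, ht⟩ : ∃ t, m - i = t + 1 := ⟨m - i - 1, by omega⟩
      have e1 : m + 1 - i = t + 2 := by omega
      rw [ht, e1]
      exact desc_q hP (by omega)
    · subst h
      obtain ⟨k, rfl⟩ : ∃ k, i = k + 1 := ⟨i - 1, by omega⟩
      have e1 : evP (k + 1 + 1) P (k + 1) = eP P (k + 1) := by simp [evP]
      have e2 : evP (k + 1 + 1) P (k + 1 - 1) = eP (qP P) k := by
        rw [evP, Function.update_of_ne (by omega)]; simp [evP]
      rw [e1, e2]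
      have e3 : k + 1 + 1 - (k + 1) = 1 := by omega
      rw [e3, hP.first (by omega)]
      rcases hP.second (by omega) with h | h
      · have := holes_right hP h k (by omega)
        rw [h]; simp; exact this.1
      · have := holes_down hP h k (by omega)
        rw [h]; simp [this.2]

/-! ### Descent sets -/

theorem mem_dsi {n : ℕ} {P : ℕ → ℕ × ℕ} (hP : Valid n P) (i : ℕ) :
    i ∈ DsiSet n (tab n P) ↔ 0 < i ∧ i < n ∧ (P (i - 1)).1 < (P i).1 := by
  simp only [DsiSet, Finset.mem_filter, Finset.mem_Ioo, and_assoc]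
  refine and_congr_right fun h0 => and_congr_right fun h1 => ?_
  obtain ⟨k, rfl⟩ : ∃ k, i = k + 1 := ⟨i - 1, by omega⟩
  rw [rowIdx_tab hP (by omega), rowIdx_tab hP (by omega)]
  rfl

theorem dsic_ev {n : ℕ} {P : ℕ → ℕ × ℕ} (hP : Valid n P) :
    Dsic n (tab n (evP n P)) = DsiSet n (tab n P) := by
  ext i
  simp only [Dsic, Finset.mem_image, mem_dsi (valid_ev n P hP).1]
  rw [mem_dsi hP]
  constructor
  · rintro ⟨j, ⟨h1, h2, h3⟩, rfl⟩
    exact ⟨by omega, by omega, (desc_ev n P hP j h1 h2).1 h3⟩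
  · rintro ⟨h1, h2, h3⟩
    refine ⟨n - i, ⟨by omega, by omega, ?_⟩, by omega⟩
    rw [desc_ev n P hP (n - i) (by omega) (by omega)]
    rwa [show n - (n - i) = i by omega]

theorem dsi_ev {n : ℕ} {P : ℕ → ℕ × ℕ} (hP : Valid n P) :
    DsiSet n (tab n (evP n P)) = Dsic n (tab n P) := by
  rw [Dsic, ← dsic_ev hP, Dsic, Finset.image_image]
  ext i
  simp only [Finset.mem_image, Function.comp]
  have hb : ∀ j ∈ DsiSet n (tab n (evP n P)), n - (n - j) = j := by
    intro j hj
    have := (Finset.mem_filter.1 hj).1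
    rw [Finset.mem_Ioo] at this
    omega
  constructor
  · intro h; exact ⟨i, h, hb i h⟩
  · rintro ⟨j, hj, rfl⟩; rw [hb j hj]; exact hj

theorem tab_add (n : ℕ) (P : ℕ → ℕ × ℕ) (v : ℕ × ℕ) :
    Function.update (tab n P) v (n + 1) = tab (n + 1) (Function.update P n v) := by
  rw [tab, Function.update_self]
  congr 1
  apply tab_congr
  intro j hj
  rw [Function.update_of_ne (by omega)]

theorem dsi_add {n : ℕ} {P : ℕ → ℕ × ℕ} {v : ℕ × ℕ} (hP : Valid n P)
    (hv : Valid (n + 1) (Function.update P n v)) :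
    (rowIdx (tab n P) n < v.1 →
        DsiSet (n + 1) (Function.update (tab n P) v (n + 1)) = insert n (DsiSet n (tab n P))) ∧
     (¬ rowIdx (tab n P) n < v.1 →
        DsiSet (n + 1) (Function.update (tab n P) v (n + 1)) = DsiSet n (tab n P)) := by
  rw [tab_add]
  have hlt : ∀ i, i < n → (i ∈ DsiSet (n + 1) (tab (n + 1) (Function.update P n v)) ↔
      i ∈ DsiSet n (tab n P)) := by
    intro i hi
    rw [mem_dsi hv, mem_dsi hP, Function.update_of_ne (by omega), Function.update_of_ne (by omega)]
    constructor <;> rintro ⟨h1, h2, h3⟩ <;> exact ⟨h1, by omega, h3⟩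
  have hge : ∀ i, n < i → i ∉ DsiSet (n + 1) (tab (n + 1) (Function.update P n v)) := by
    intro i hi h
    rw [mem_dsi hv] at h; omega
  have hge' : ∀ i, n ≤ i → i ∉ DsiSet n (tab n P) := by
    intro i hi h
    rw [mem_dsi hP] at h; omega
  have hn : n ∈ DsiSet (n + 1) (tab (n + 1) (Function.update P n v)) ↔
      rowIdx (tab n P) n < v.1 := by
    rw [mem_dsi hv, Function.update_self]
    rcases Nat.eq_zero_or_pos n with h0 | h0
    · subst h0
      have := hv.first (by omega)
      rw [Function.update_self] at this
      simp [this]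
    · obtain ⟨k, rfl⟩ : ∃ k, n = k + 1 := ⟨n - 1, by omega⟩
      rw [rowIdx_tab hP (by omega), Function.update_of_ne (by omega)]
      simp
  constructor
  · intro h
    ext i
    rw [Finset.mem_insert]
    rcases lt_trichotomy i n with h1 | h1 | h1
    · rw [hlt i h1]; constructor
      · exact Or.inr
      · rintro (h | h)
        · omega
        · exact h
    · subst h1; simp [hn, h]
    · have := hge i h1
      have h2 := hge' i (by omega)
      constructor
      · intro h; exact (this h).elim
      · rintro (h | h)
        · omega
        · exact (h2 h).elim
  · intro h
    ext i
    rcases lt_trichotomy i n with h1 | h1 | h1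
    · exact hlt i h1
    · subst h1
      have := hge' i le_rfl
      rw [hn]; tauto
    · have := hge i h1
      have h2 := hge' i (by omega)
      tauto

theorem exists_path {μ : YoungDiagram} {T : Tab} (hT : IsStandard μ T) :
    ∃ P, Valid μ.cells.card P ∧ (∀ c, c ∈ μ.cells ↔ c ∈ Lam μ.cells.card P) ∧
      T = tab μ.cells.card P := by
  obtain ⟨⟨h0, hb⟩, hs⟩ := hT
  have hex : ∀ i, i < μ.cells.card → ∃ c, c ∈ μ.cells ∧ T c = i + 1 := by
    intro i hi
    obtain ⟨c, hc, h⟩ := hb.surjOn (show i + 1 ∈ Set.Icc 1 μ.cells.card from ⟨by omega, by omega⟩)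
    exact ⟨c, hc, h⟩
  choose! P hP using hex
  have hinv : ∀ c ∈ μ.cells, ∃ m < μ.cells.card, T c = m + 1 ∧ P m = c := by
    intro c hc
    have := hb.mapsTo hc
    rw [Set.mem_Icc] at this
    refine ⟨T c - 1, by omega, by omega, ?_⟩
    have h1 := hP (T c - 1) (by omega)
    exact hb.injOn h1.1 hc (by rw [h1.2]; omega)
  have hL : ∀ k ≤ μ.cells.card, ∀ c, c ∈ Lam k P ↔ c ∈ μ.cells ∧ T c ≤ k := by
    intro k hk c
    constructor
    · rintro ⟨j, hj, rfl⟩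
      have := hP j (by omega)
      exact ⟨this.1, by omega⟩
    · rintro ⟨h1, h2⟩
      obtain ⟨m, hm, h3, h4⟩ := hinv c h1
      exact ⟨m, by omega, h4⟩
  have hV : Valid μ.cells.card P := by
    intro k hk
    refine ⟨?_, ?_⟩
    · rw [hL k (by omega), (hP k hk).2]; omega
    · intro a b c d hab hca hdb
      rw [hL _ (by omega)] at hab ⊢
      have hm : (c, d) ∈ μ.cells := μ.isLowerSet (show (c, d) ≤ (a, b) from ⟨hca, hdb⟩) hab.1
      refine ⟨hm, ?_⟩
      by_cases he : (c, d) = (a, b)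
      · rw [he]; exact hab.2
      · have := hs (c, d) hm (a, b) hab.1 he hca hdb
        omega
  have hL' : ∀ c, c ∈ μ.cells ↔ c ∈ Lam μ.cells.card P := by
    intro c
    rw [hL _ le_rfl]
    constructor
    · intro h; exact ⟨h, (Set.mem_Icc.1 (hb.mapsTo h)).2⟩
    · exact fun h => h.1
  refine ⟨P, hV, hL', ?_⟩
  funext c
  by_cases hc : c ∈ μ.cells
  · obtain ⟨m, hm, h3, h4⟩ := hinv c hc
    rw [h3, ← h4, tab_apply hV hm]
  · rw [h0 c hc, (tab_zero_iff hV c).2 (by rwa [← hL'])]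

theorem valid_corner {μ : YoungDiagram} {n : ℕ} {P : ℕ → ℕ × ℕ} {v : ℕ × ℕ} (hP : Valid n P)
    (hL : ∀ c, c ∈ μ.cells ↔ c ∈ Lam n P) (hv : IsCorner μ v) :
    Valid (n + 1) (Function.update P n v) ∧
      ∀ c, c ∈ insert v μ.cells ↔ c ∈ Lam (n + 1) (Function.update P n v) := by
  obtain ⟨hv1, ν, hν⟩ := hv
  have hcg : ∀ j < n, P j = Function.update P n v j := by
    intro j hj
    rw [Function.update_of_ne (by omega)]
  have hmem : ∀ c, c ∈ insert v μ.cells ↔ c ∈ Lam (n + 1) (Function.update P n v) := by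
    intro c
    rw [Lam_succ, Function.update_self, ← Lam_congr hcg, Finset.mem_insert, hL]; rfl
  refine ⟨?_, hmem⟩
  intro k hk
  rcases Nat.lt_succ_iff_lt_or_eq.1 hk with h | h
  · exact (hP.congr hcg) k h
  · subst h
    constructor
    · rw [← Lam_congr hcg, Function.update_self, ← hL]; exact hv1
    · intro a b c d hab hca hdb
      rw [← hmem, ← hν] at hab ⊢
      exact ν.isLowerSet (show (c, d) ≤ (a, b) from ⟨hca, hdb⟩) hab

/-! ### Cocharge tableaux -/

theorem cells_eq {n : ℕ} {P : ℕ → ℕ × ℕ} {cells : Finset (ℕ × ℕ)}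
    (hL : ∀ c, c ∈ cells ↔ c ∈ Lam n P) : cells = (Finset.range n).image P := by
  ext c
  rw [hL]
  simp [Lam]

theorem ct_apply {n : ℕ} {P : ℕ → ℕ × ℕ} (hP : Valid n P) {i : ℕ} (hi : i < n) :
    ctTab n (tab n P) (P i) = ((DsiSet n (tab n P)).filter fun d => d ≤ i).card := by
  rw [ctTab, ctEntry, tab_apply hP hi]
  congr 1
  apply Finset.filter_congr
  intro d _
  omega

theorem cc_eq {n : ℕ} {P : ℕ → ℕ × ℕ} (hP : Valid n P) :
    ccStat n (tab n P) = ∑ x ∈ Dsic n (tab n P), x := by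
  have h1 : ccStat n (tab n P) = ∑ i ∈ Finset.range n,
      ((DsiSet n (tab n P)).filter fun d => d ≤ i).card := by
    rw [ccStat, Finset.range_eq_Ico]
    have : Finset.Icc 1 n = Finset.Ico (0 + 1) (n + 1) := by ext; simp <;> omega
    rw [this, ← Finset.sum_Ico_add']
    apply Finset.sum_congr rfl
    intro i hi
    have hi' := (Finset.mem_Ico.1 hi).2
    rw [posOf_tab hP hi']
    exact ct_apply hP hi'
  rw [h1, Dsic, Finset.sum_image]
  · simp only [Finset.card_filter]
    rw [Finset.sum_comm]
    apply Finset.sum_congr rfl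
    intro d hd
    rw [← Finset.card_filter]
    have : (Finset.range n).filter (fun i => d ≤ i) = Finset.Ico d n := by ext; simp; omega
    rw [this, Nat.card_Ico]
  · intro a ha b hb hab
    have ha' := (mem_dsi hP a).1 ha
    have hb' := (mem_dsi hP b).1 hb
    simp only at hab
    omega

theorem entrySum_ct {n : ℕ} {P : ℕ → ℕ × ℕ} (hP : Valid n P) {cells : Finset (ℕ × ℕ)}
    (hL : ∀ c, c ∈ cells ↔ c ∈ Lam n P) :
    entrySum cells (ctTab n (tab n P)) = ccStat n (tab n P) := by
  rw [entrySum, cells_eq hL, Finset.sum_image, ccStat, Finset.range_eq_Ico]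
  · have : Finset.Icc 1 n = Finset.Ico (0 + 1) (n + 1) := by ext; simp <;> omega
    rw [this, ← Finset.sum_Ico_add']
    apply Finset.sum_congr rfl
    intro i hi
    have hi' := (Finset.mem_Ico.1 hi).2
    rw [posOf_tab hP hi']
    rfl
  · intro a ha b hb hab
    simp only [Finset.coe_range, Set.mem_Iio] at ha hb
    exact hP.inj ha hb hab

theorem card_filter_cells {n : ℕ} {P : ℕ → ℕ × ℕ} (hP : Valid n P) {cells : Finset (ℕ × ℕ)}
    (hL : ∀ c, c ∈ cells ↔ c ∈ Lam n P) (q : ℕ × ℕ → Prop) [DecidablePred q] (d : ℕ)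
    (hd : d ≤ n)
    (hq : ∀ i < n, q (P i) ↔ i < d) : (cells.filter q).card = d := by
  have : cells.filter q = (Finset.range d).image P := by
    ext c
    rw [Finset.mem_filter, hL, Finset.mem_image]
    constructor
    · rintro ⟨⟨j, hj, rfl⟩, h⟩
      exact ⟨j, Finset.mem_range.2 ((hq j hj).1 h), rfl⟩
    · rintro ⟨j, hj, rfl⟩
      rw [Finset.mem_range] at hj
      exact ⟨⟨j, by omega, rfl⟩, (hq j (by omega)).2 hj⟩
  rw [this, Finset.card_image_of_injOn, Finset.card_range]
  intro a ha b hb hab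
  simp only [Finset.coe_range, Set.mem_Iio] at ha hb
  exact hP.inj (by omega) (by omega) hab

theorem kOf_ct {n : ℕ} {P : ℕ → ℕ × ℕ} (hP : Valid n P) {cells : Finset (ℕ × ℕ)}
    (hL : ∀ c, c ∈ cells ↔ c ∈ Lam n P) :
    kOf cells (ctTab n (tab n P)) = (DsiSet n (tab n P)).card + 1 := by
  rw [kOf]
  congr 1
  apply le_antisymm
  · apply Finset.sup_le
    intro c _
    rw [ctTab, ctEntry]
    exact Finset.card_filter_le (DsiSet n (tab n P)) (fun j => j < tab n P c)
  · rcases Nat.eq_zero_or_pos n with h0 | h0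
    · subst h0
      simp [DsiSet]
    · have h1 : P (n - 1) ∈ cells := (hL _).2 ⟨n - 1, by omega, rfl⟩
      have h2 := Finset.le_sup (f := ctTab n (tab n P)) h1
      rw [ct_apply hP (by omega), Finset.filter_true_of_mem] at h2
      · exact h2
      · intro d hd
        have := (mem_dsi hP d).1 hd
        omega

theorem dspc_ct {n : ℕ} {P : ℕ → ℕ × ℕ} (hP : Valid n P) {cells : Finset (ℕ × ℕ)}
    (hL : ∀ c, c ∈ cells ↔ c ∈ Lam n P) :
    Dspc n cells (ctTab n (tab n P)) = Dsic n (tab n P) := by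
  rw [Dspc, Dsic, kOf_ct hP hL]
  congr 1
  symm
  apply Finset.eq_of_subset_of_card_le
  · intro d hd
    have hd' := (mem_dsi hP d).1 hd
    rw [gctType, Finset.mem_image]
    refine ⟨((DsiSet n (tab n P)).filter fun x => x ≤ d).card, ?_, ?_⟩
    · rw [Finset.mem_Ico]
      refine ⟨Finset.card_pos.2 ⟨d, by simp [hd]⟩, ?_⟩
      have := Finset.card_filter_le (DsiSet n (tab n P)) (fun x => x ≤ d)
      omega
    · apply card_filter_cells hP hL _ d (by omega)
      intro i hi
      rw [ct_apply hP hi]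
      constructor
      · intro h
        by_contra h2
        have : ((DsiSet n (tab n P)).filter fun x => x ≤ d) ⊆
            (DsiSet n (tab n P)).filter fun x => x ≤ i := by
          intro x hx
          rw [Finset.mem_filter] at hx ⊢
          exact ⟨hx.1, by omega⟩
        have := Finset.card_le_card this
        omega
      · intro h
        apply Finset.card_lt_card
        refine ⟨?_, ?_⟩
        · intro x hx
          rw [Finset.mem_filter] at hx ⊢
          exact ⟨hx.1, by omega⟩
        · intro h3
          have := h3 (Finset.mem_filter.2 ⟨hd, le_rfl⟩)
          rw [Finset.mem_filter] at this
          omega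
  · rw [gctType]
    refine Finset.card_image_le.trans ?_
    rw [Nat.card_Ico]; omega

/-- Between equal cocharge values the columns strictly increase. -/
theorem col_lt {n : ℕ} {P : ℕ → ℕ × ℕ} (hP : Valid n P) {i j : ℕ} (hij : i < j) (hj : j < n)
    (h : ∀ d ∈ DsiSet n (tab n P), ¬ (i < d ∧ d ≤ j)) : (P i).2 < (P j).2 := by
  induction j, hij using Nat.le_induction with
  | base =>
    change (P i).2 < (P (i + 1)).2
    by_contra hc
    have h1 := h (i + 1)
    rw [mem_dsi hP] at h1
    have h2 : ¬ (P i).1 < (P (i + 1)).1 := by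
      intro h3
      exact h1 ⟨by omega, by omega, h3⟩ ⟨by omega, by omega⟩
    exact (hP (i + 1) hj).1 ((hP i (by omega)).2 (P i).1 (P i).2 _ _ ⟨i, by omega, rfl⟩
      (by omega) (by omega))
  | succ j hij ih =>
    have ih := ih (by omega) (fun d hd h' => h d hd ⟨h'.1, by omega⟩)
    refine ih.trans ?_
    by_contra hc
    have h1 := h (j + 1)
    rw [mem_dsi hP] at h1
    have h2 : ¬ (P j).1 < (P (j + 1)).1 := by
      intro h3
      exact h1 ⟨by omega, by omega, h3⟩ ⟨by omega, by omega⟩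
    exact (hP (j + 1) hj).1 ((hP j (by omega)).2 (P j).1 (P j).2 _ _ ⟨j, by omega, rfl⟩
      (by omega) (by omega))

theorem ct_cmp {n : ℕ} {P : ℕ → ℕ × ℕ} (hP : Valid n P) {i j : ℕ} (hij : i < j) (hj : j < n) :
    ctTab n (tab n P) (P i) < ctTab n (tab n P) (P j) ∨
      (ctTab n (tab n P) (P i) = ctTab n (tab n P) (P j) ∧ (P i).2 < (P j).2) := by
  rw [ct_apply hP hj, ct_apply hP (by omega)]
  have hsub : ((DsiSet n (tab n P)).filter fun x => x ≤ i) ⊆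
      (DsiSet n (tab n P)).filter fun x => x ≤ j := by
    intro x hx
    rw [Finset.mem_filter] at hx ⊢
    exact ⟨hx.1, by omega⟩
  rcases (Finset.card_le_card hsub).lt_or_eq with h | h
  · exact Or.inl h
  · right
    refine ⟨h, col_lt hP hij hj ?_⟩
    have he := Finset.eq_of_subset_of_card_le hsub h.ge
    rintro d hd ⟨h1, h2⟩
    have : d ∈ (DsiSet n (tab n P)).filter fun x => x ≤ i := by
      rw [he]; exact Finset.mem_filter.2 ⟨hd, h2⟩
    rw [Finset.mem_filter] at this
    omega

theorem stdz_ct {n : ℕ} {P : ℕ → ℕ × ℕ} (hP : Valid n P) {cells : Finset (ℕ × ℕ)}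
    (hL : ∀ c, c ∈ cells ↔ c ∈ Lam n P) :
    stdz cells (ctTab n (tab n P)) = tab n P := by
  funext c
  rw [stdz]
  by_cases hc : c ∈ cells
  · rw [if_pos hc]
    obtain ⟨i, hi, rfl⟩ := (hL c).1 hc
    rw [tab_apply hP hi]
    apply card_filter_cells hP hL _ (i + 1) (by omega)
    intro j hj
    rcases lt_trichotomy i j with h | h | h
    · have := ct_cmp hP h hj
      omega
    · subst h; simp
    · have := ct_cmp hP h hi
      omega
  · rw [if_neg hc]
    exact ((tab_zero_iff hP c).2 (by rwa [← hL])).symm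

/-- Everything about `S +̃ v`. -/
theorem sadd_facts {μ : YoungDiagram} {n : ℕ} {P : ℕ → ℕ × ℕ} {v : ℕ × ℕ} (hP : Valid n P)
    (hL : ∀ c, c ∈ μ.cells ↔ c ∈ Lam n P) (hv : IsCorner μ v) :
    ∃ R, Valid (n + 1) R ∧ (∀ c, c ∈ insert v μ.cells ↔ c ∈ Lam (n + 1) R) ∧
      Sadd n (tab n P) v = tab (n + 1) R ∧
      (rowIdx (evac n (tab n P)) n < v.1 →
        Dsic (n + 1) (tab (n + 1) R) = insert n (Dsic n (tab n P))) ∧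
      (¬ rowIdx (evac n (tab n P)) n < v.1 →
        Dsic (n + 1) (tab (n + 1) R) = Dsic n (tab n P)) := by
  obtain ⟨e1, e2⟩ := valid_ev n P hP
  obtain ⟨c1, c2⟩ := valid_corner (P := evP n P) e1 (by rw [e2]; exact hL) hv
  obtain ⟨f1, f2⟩ := valid_ev (n + 1) _ c1
  refine ⟨evP (n + 1) (Function.update (evP n P) n v), f1, by rw [f2]; exact c2, ?_, ?_⟩
  · rw [Sadd, evac_tab n P hP, tab_add, evac_tab _ _ c1]
  · rw [dsic_ev c1, evac_tab n P hP, ← dsi_ev hP, ← tab_add]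
    exact dsi_add e1 c1

theorem dsi_sub (n : ℕ) (T : Tab) : DsiSet n T ⊆ Finset.Ioo 0 n := Finset.filter_subset _ _

theorem dsic_sub (n : ℕ) (T : Tab) : Dsic n T ⊆ Finset.Ioo 0 n := by
  intro x hx
  obtain ⟨i, hi, rfl⟩ := Finset.mem_image.1 hx
  have := Finset.mem_Ioo.1 (dsi_sub n T hi)
  rw [Finset.mem_Ioo]
  omega

theorem restrict {A B : Finset ℕ} {n : ℕ} {p : Prop} (hA : A ⊆ Finset.Ioo 0 n)
    (h : (p → B = insert n A) ∧ (¬ p → B = A)) : A = B ∩ Finset.Ioo 0 n := by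
  by_cases hp : p
  · rw [h.1 hp, Finset.insert_inter_of_notMem (by simp)]
    exact (Finset.inter_eq_left.2 hA).symm
  · rw [h.2 hp]
    exact (Finset.inter_eq_left.2 hA).symm

theorem sum_change {A B : Finset ℕ} {n : ℕ} {p : Prop} (hA : A ⊆ Finset.Ioo 0 n)
    (h : (p → B = insert n A) ∧ (¬ p → B = A)) :
    (p → ∑ x ∈ B, x = ∑ x ∈ A, x + n) ∧ (¬ p → ∑ x ∈ B, x = ∑ x ∈ A, x) := by
  constructor
  · intro hp
    rw [h.1 hp, Finset.sum_insert, add_comm]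
    intro hn
    have := hA hn
    simp at this
  · intro hp
    rw [h.2 hp]

/-- Behaviour of the descent data under adding an external corner `v`:
(i)–(iii) describe `Dsi(T+v)`, `Dsi^c(S +̃ v)` and `Dsp^c(C +̂ v)`, (iv) the entry sums and
cocharges, and (v) the restrictions back to `{1,…,n-1}`. -/
theorem statement_19 (n : ℕ) (μ : YoungDiagram) (hμ : μ.cells.card = n)
    (T S C : Tab) (hT : IsStandard μ T) (hS : IsStandard μ S) (hC : IsCCT μ C)
    (v : ℕ × ℕ) (hv : IsCorner μ v) :
    -- (i)
    ((rowIdx T n < v.1 →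
        DsiSet (n + 1) (Function.update T v (n + 1)) = insert n (DsiSet n T)) ∧
     (¬ rowIdx T n < v.1 →
        DsiSet (n + 1) (Function.update T v (n + 1)) = DsiSet n T)) ∧
    -- (ii)
    ((rowIdx (evac n S) n < v.1 → Dsic (n + 1) (Sadd n S v) = insert n (Dsic n S)) ∧
     (¬ rowIdx (evac n S) n < v.1 → Dsic (n + 1) (Sadd n S v) = Dsic n S)) ∧
    -- (iii)
    ((rowIdx (evac n (stdz μ.cells C)) n < v.1 →
        Dspc (n + 1) (insert v μ.cells) (Cadd n μ C v) = insert n (Dspc n μ.cells C)) ∧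
     (¬ rowIdx (evac n (stdz μ.cells C)) n < v.1 →
        Dspc (n + 1) (insert v μ.cells) (Cadd n μ C v) = Dspc n μ.cells C)) ∧
    -- (iv)
    ((¬ rowIdx (evac n (stdz μ.cells C)) n < v.1 →
        entrySum (insert v μ.cells) (Cadd n μ C v) = entrySum μ.cells C) ∧
     (¬ rowIdx (evac n S) n < v.1 → ccStat (n + 1) (Sadd n S v) = ccStat n S) ∧
     (rowIdx (evac n (stdz μ.cells C)) n < v.1 →
        entrySum (insert v μ.cells) (Cadd n μ C v) = entrySum μ.cells C + n) ∧
     (rowIdx (evac n S) n < v.1 → ccStat (n + 1) (Sadd n S v) = ccStat n S + n)) ∧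
    -- (v)
    (DsiSet n T = DsiSet (n + 1) (Function.update T v (n + 1)) ∩ Finset.Ioo 0 n ∧
     Dsic n S = Dsic (n + 1) (Sadd n S v) ∩ Finset.Ioo 0 n ∧
     Dspc n μ.cells C = Dspc (n + 1) (insert v μ.cells) (Cadd n μ C v) ∩ Finset.Ioo 0 n) := by
  subst hμ
  obtain ⟨PT, vT, lT, rfl⟩ := exists_path hT
  obtain ⟨PS, vS, lS, rfl⟩ := exists_path hS
  obtain ⟨S', hS', rfl⟩ := hC
  obtain ⟨PC, vC, lC, rfl⟩ := exists_path hS'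
  have hi := dsi_add vT (valid_corner vT lT hv).1
  obtain ⟨R, vR, lR, eR, hR⟩ := sadd_facts vS lS hv
  obtain ⟨U, vU, lU, eU, hU⟩ := sadd_facts vC lC hv
  have hstd := stdz_ct vC lC
  have hCadd : Cadd μ.cells.card μ (ctTab μ.cells.card (tab μ.cells.card PC)) v
      = ctTab (μ.cells.card + 1) (tab (μ.cells.card + 1) U) := by
    rw [Cadd, hstd, eU]
  rw [hCadd, hstd, eR, dspc_ct vU lU, dspc_ct vC lC, entrySum_ct vU lU, entrySum_ct vC lC,
    cc_eq vU, cc_eq vC, cc_eq vR, cc_eq vS]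
  have s1 := sum_change (dsic_sub _ _) hR
  have s2 := sum_change (dsic_sub _ _) hU
  exact ⟨hi, hR, hU, ⟨s2.2, s1.2, s2.1, s1.1⟩, restrict (dsi_sub _ _) hi,
    restrict (dsic_sub _ _) hR, restrict (dsic_sub _ _) hU⟩

end HigherSpecht
end
end
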